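/- Let k ≥ 1 be an integer and let G be a finite simple graph with exactly 3k vertices, χ(G) ≤ k, and Δ(G) ≤ k. Then G has no equitable k-coloring if and only if k is odd and G is isomorphic to the disjoint union K_{k,k} + K_k of the complete bipartite graph K_{k,k} and the complete graph K_k. -/

import Mathlib

/-- `G` has an equitable `k`-coloring: a proper coloring with `k` colors in which any two
color classes differ in size by at most one. -/
def SimpleGraph.HasEquitableColoring {V : Type*} [Fintype V] (G : SimpleGraph V) (k : ℕ) :
    Prop :=
  ∃ C : G.Coloring (Fin k), ∀ i j : Fin k,
    (Finset.univ.filter fun v => C v = i).card ≤ (Finset.univ.filter fun v => C v = j).card + 1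

/-- The join `G ∨ H` of two graphs: their disjoint union together with all edges between the
two vertex sets. -/
def SimpleGraph.join {α β : Type*} (G : SimpleGraph α) (H : SimpleGraph β) :
    SimpleGraph (α ⊕ β) where
  Adj x y :=
    Sum.elim (fun a => Sum.elim (fun b => G.Adj a b) (fun _ => True) y)
             (fun a => Sum.elim (fun _ => True) (fun b => H.Adj a b) y) x
  symm := by
    constructor
    rintro (a | a) (b | b) h
    · exact G.symm.symm _ _ h
    · trivial
    · trivial
    · exact H.symm.symm _ _ h
  loopless := by
    constructor
    rintro (a | a) h
    · exact G.loopless.irrefl a h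
    · exact H.loopless.irrefl a h

instance {α β : Type*} (G : SimpleGraph α) (H : SimpleGraph β) [DecidableRel G.Adj]
    [DecidableRel H.Adj] : DecidableRel (G.join H).Adj := fun x y =>
  match x, y with
  | Sum.inl a, Sum.inl b => inferInstanceAs (Decidable (G.Adj a b))
  | Sum.inl _, Sum.inr _ => inferInstanceAs (Decidable True)
  | Sum.inr _, Sum.inl _ => inferInstanceAs (Decidable True)
  | Sum.inr a, Sum.inr b => inferInstanceAs (Decidable (H.Adj a b))

/-- The disjoint union `G + H` of two graphs. -/
def SimpleGraph.disjUnion {α β : Type*} (G : SimpleGraph α) (H : SimpleGraph β) :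
    SimpleGraph (α ⊕ β) where
  Adj x y :=
    Sum.elim (fun a => Sum.elim (fun b => G.Adj a b) (fun _ => False) y)
             (fun a => Sum.elim (fun _ => False) (fun b => H.Adj a b) y) x
  symm := by
    constructor
    rintro (a | a) (b | b) h
    · exact G.symm.symm _ _ h
    · exact h.elim
    · exact h.elim
    · exact H.symm.symm _ _ h
  loopless := by
    constructor
    rintro (a | a) h
    · exact G.loopless.irrefl a h
    · exact H.loopless.irrefl a h

instance {α β : Type*} (G : SimpleGraph α) (H : SimpleGraph β) [DecidableRel G.Adj]
    [DecidableRel H.Adj] : DecidableRel (G.disjUnion H).Adj := fun x y =>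
  match x, y with
  | Sum.inl a, Sum.inl b => inferInstanceAs (Decidable (G.Adj a b))
  | Sum.inl _, Sum.inr _ => inferInstanceAs (Decidable False)
  | Sum.inr _, Sum.inl _ => inferInstanceAs (Decidable False)
  | Sum.inr a, Sum.inr b => inferInstanceAs (Decidable (H.Adj a b))

set_option linter.unusedSectionVars false
set_option linter.unusedVariables false

namespace EqCol

/-- adjacency as a Boolean -/
noncomputable def A {V : Type*} (H : SimpleGraph V) (u v : V) : Bool :=
  @decide (H.Adj u v) (Classical.propDecidable _)

/-- number of neighbours of `u` in the multiset `T` -/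
noncomputable def e {V : Type*} (H : SimpleGraph V) (u : V) (T : Multiset V) : ℕ :=
  (T.map fun v => (A H u v).toNat).sum

/-- sum of `e` over a family of classes -/
noncomputable def S {V : Type*} (H : SimpleGraph V) (u : V) (M : Multiset (Multiset V)) : ℕ :=
  (M.map (e H u)).sum

/-- independent triple -/
def Tri {V : Type*} (H : SimpleGraph V) (T : Multiset V) : Prop :=
  Multiset.card T = 3 ∧ ∀ u ∈ T, ∀ v ∈ T, A H u v = false

/-- the vertex set is partitioned into `s` and the independent triples of `M` -/
structure Part {V : Type*} [Fintype V] (H : SimpleGraph V) (s : Multiset V)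
    (M : Multiset (Multiset V)) : Prop where
  sum : s + M.sum = (Finset.univ : Finset V).val
  ok : ∀ T ∈ M, Tri H T

/-- working hypotheses -/
structure Ctx {V : Type*} [Fintype V] (H : SimpleGraph V) (k : ℕ) : Prop where
  card : Fintype.card V = 3 * k
  deg : ∀ u, e H u (Finset.univ : Finset V).val ≤ k
  ne : ∀ M, ¬ Part H 0 M

section basics
variable {V : Type*} {H : SimpleGraph V}

theorem A_iff {u v : V} : A H u v = true ↔ H.Adj u v := by simp [A]

theorem A_comm (u v : V) : A H u v = A H v u := by simp [A, H.adj_comm]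

theorem A_self (u : V) : A H u u = false := by simp [A]

theorem e_add (u : V) (s t : Multiset V) : e H u (s + t) = e H u s + e H u t := by simp [e]

theorem e_single (u v : V) : e H u {v} = (A H u v).toNat := by simp [e]

theorem e3 (u a b c : V) :
    e H u ({a} + {b} + {c}) = (A H u a).toNat + (A H u b).toNat + (A H u c).toNat := by
  simp only [e_add, e_single]

theorem S_cons (u : V) (T : Multiset V) (M : Multiset (Multiset V)) :
    S H u (T ::ₘ M) = e H u T + S H u M := by simp [S]

theorem S_zero (u : V) : S H u 0 = 0 := by simp [S]

theorem e_sum (u : V) (M : Multiset (Multiset V)) : e H u M.sum = S H u M := by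
  induction M using Multiset.induction with
  | empty => simp [e, S]
  | cons T M ih => simp only [Multiset.sum_cons, e_add, S_cons, ih]

theorem tri_mk {a b c : V} (h1 : A H a b = false) (h2 : A H a c = false) (h3 : A H b c = false) :
    Tri H ({a} + {b} + {c}) := by
  refine ⟨by simp, ?_⟩
  have h1' := h1; have h2' := h2; have h3' := h3
  rw [A_comm] at h1' h2' h3'
  simp only [Multiset.mem_add, Multiset.mem_singleton]
  rintro u ((rfl | rfl) | rfl) v ((rfl | rfl) | rfl) <;> simp_all [A_self]

theorem tri_bits {a b c : V} (h : Tri H ({a} + {b} + {c})) :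
    A H a b = false ∧ A H a c = false ∧ A H b c = false := by
  refine ⟨h.2 _ ?_ _ ?_, h.2 _ ?_ _ ?_, h.2 _ ?_ _ ?_⟩ <;> simp

theorem tri_exists {T : Multiset V} (h : Tri H T) : ∃ a b c, T = {a} + {b} + {c} := by
  obtain ⟨a, b, c, rfl⟩ := Multiset.card_eq_three.1 h.1
  exact ⟨a, b, c, rfl⟩

/-- reorder a triple so that the elements with property `Q` come first -/
theorem sort3 (Q : V → Bool) (a b c : V) :
    ∃ a' b' c', ({a} + {b} + {c} : Multiset V) = {a'} + {b'} + {c'} ∧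
      (Q a').toNat + (Q b').toNat + (Q c').toNat = (Q a).toNat + (Q b).toNat + (Q c).toNat ∧
      (Q b' = true → Q a' = true) ∧ (Q c' = true → Q b' = true) := by
  cases ha : Q a <;> cases hb : Q b <;> cases hc : Q c
  · exact ⟨a, b, c, rfl, by simp [*], by simp [*], by simp [*]⟩
  · exact ⟨c, b, a, by abel, by simp [*], by simp [*], by simp [*]⟩
  · exact ⟨b, a, c, by abel, by simp [*], by simp [*], by simp [*]⟩
  · exact ⟨b, c, a, by abel, by simp [*], by simp [*], by simp [*]⟩
  · exact ⟨a, b, c, rfl, by simp [*], by simp [*], by simp [*]⟩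
  · exact ⟨a, c, b, by abel, by simp [*], by simp [*], by simp [*]⟩
  · exact ⟨a, b, c, rfl, by simp [*], by simp [*], by simp [*]⟩
  · exact ⟨a, b, c, rfl, by simp [*], by simp [*], by simp [*]⟩

theorem sort_e {T : Multiset V} (h : Tri H T) (u : V) :
    ∃ a b c, T = {a} + {b} + {c} ∧
      (A H u a).toNat + (A H u b).toNat + (A H u c).toNat = e H u T ∧
      (A H u b = true → A H u a = true) ∧ (A H u c = true → A H u b = true) := by
  obtain ⟨a, b, c, rfl⟩ := tri_exists h
  obtain ⟨a', b', c', h1, h2, h3, h4⟩ := sort3 (fun v => A H u v) a b c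
  exact ⟨a', b', c', h1, by rw [h2, e3], h3, h4⟩

theorem sort_e0 {T : Multiset V} (h : Tri H T) (u : V) (he : e H u T = 0) :
    ∃ a b c, T = {a} + {b} + {c} ∧ A H u a = false ∧ A H u b = false ∧ A H u c = false := by
  obtain ⟨a, b, c, h1, h2, h3, h4⟩ := sort_e h u
  refine ⟨a, b, c, h1, ?_⟩
  rw [he] at h2; revert h2 h3 h4
  cases A H u a <;> cases A H u b <;> cases A H u c <;> simp

theorem sort_e1 {T : Multiset V} (h : Tri H T) (u : V) (he : e H u T = 1) :
    ∃ a b c, T = {a} + {b} + {c} ∧ A H u a = true ∧ A H u b = false ∧ A H u c = false := by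
  obtain ⟨a, b, c, h1, h2, h3, h4⟩ := sort_e h u
  refine ⟨a, b, c, h1, ?_⟩
  rw [he] at h2; revert h2 h3 h4
  cases A H u a <;> cases A H u b <;> cases A H u c <;> simp

theorem sort_e2 {T : Multiset V} (h : Tri H T) (u : V) (he : e H u T = 2) :
    ∃ a b c, T = {a} + {b} + {c} ∧ A H u a = true ∧ A H u b = true ∧ A H u c = false := by
  obtain ⟨a, b, c, h1, h2, h3, h4⟩ := sort_e h u
  refine ⟨a, b, c, h1, ?_⟩
  rw [he] at h2; revert h2 h3 h4
  cases A H u a <;> cases A H u b <;> cases A H u c <;> simp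

theorem sort_e3 {T : Multiset V} (h : Tri H T) (u : V) (he : e H u T = 3) :
    ∃ a b c, T = {a} + {b} + {c} ∧ A H u a = true ∧ A H u b = true ∧ A H u c = true := by
  obtain ⟨a, b, c, h1, h2, h3, h4⟩ := sort_e h u
  refine ⟨a, b, c, h1, ?_⟩
  rw [he] at h2; revert h2 h3 h4
  cases A H u a <;> cases A H u b <;> cases A H u c <;> simp

theorem e_le3 {T : Multiset V} (h : Tri H T) (u : V) : e H u T ≤ 3 := by
  obtain ⟨a, b, c, rfl⟩ := tri_exists h
  rw [e3]
  cases A H u a <;> cases A H u b <;> cases A H u c <;> simp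

/-- summing a pointwise linear inequality -/
theorem sum_ge (M : Multiset (Multiset V)) (n α β γ δ : ℕ) (u v w z : V)
    (h : ∀ T ∈ M, n ≤ α * e H u T + β * e H v T + γ * e H w T + δ * e H z T) :
    n * Multiset.card M ≤ α * S H u M + β * S H v M + γ * S H w M + δ * S H z M := by
  induction M using Multiset.induction with
  | empty => simp
  | cons T M ih =>
    have h1 := h T (Multiset.mem_cons_self _ _)
    have h2 := ih fun T hT => h T (Multiset.mem_cons_of_mem hT)
    simp only [S_cons, Multiset.card_cons]
    linarith

end basics

section part
variable {V : Type*} [Fintype V] {H : SimpleGraph V} {k : ℕ}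

theorem Part.perm {s t : Multiset V} {M : Multiset (Multiset V)} (h : Part H s M) (hst : s = t) :
    Part H t M := hst ▸ h

theorem Part.pull {s T : Multiset V} {M : Multiset (Multiset V)} (h : Part H s (T ::ₘ M)) :
    Part H (s + T) M :=
  ⟨by have := h.sum; rw [Multiset.sum_cons] at this; rw [← this]; abel,
    fun U hU => h.ok U (Multiset.mem_cons_of_mem hU)⟩

theorem Part.push {s : Multiset V} {a b c : V} {M : Multiset (Multiset V)}
    (h : Part H (s + ({a} + {b} + {c})) M) (h1 : A H a b = false) (h2 : A H a c = false)
    (h3 : A H b c = false) : Part H s (({a} + {b} + {c}) ::ₘ M) :=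
  ⟨by have := h.sum; rw [Multiset.sum_cons]; rw [← this]; abel, by
    intro T hT
    rcases Multiset.mem_cons.1 hT with rfl | hT
    · exact tri_mk h1 h2 h3
    · exact h.ok T hT⟩

theorem Part.cardeq (C : Ctx H k) {s : Multiset V} {M : Multiset (Multiset V)} (h : Part H s M) :
    Multiset.card s + 3 * Multiset.card M = 3 * k := by
  have h1 : ∀ M : Multiset (Multiset V), (∀ T ∈ M, Tri H T) →
      Multiset.card M.sum = 3 * Multiset.card M := by
    intro M
    induction M using Multiset.induction with
    | empty => simp
    | cons T M ih =>
      intro h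
      have h1 := (h T (Multiset.mem_cons_self _ _)).1
      have h2 := ih fun T hT => h T (Multiset.mem_cons_of_mem hT)
      simp only [Multiset.sum_cons, Multiset.card_add, Multiset.card_cons]
      omega
  have h2 := congrArg Multiset.card h.sum
  rw [Multiset.card_add, h1 M h.ok] at h2
  rw [h2, ← C.card]; rfl

theorem Part.dsum {s : Multiset V} {M : Multiset (Multiset V)} (h : Part H s M)
    (u : V) : e H u s + S H u M = e H u (Finset.univ : Finset V).val := by
  rw [← h.sum, e_add, e_sum]

theorem Part.deg (C : Ctx H k) {s : Multiset V} {M : Multiset (Multiset V)} (h : Part H s M)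
    (u : V) : e H u s + S H u M ≤ k := by
  rw [h.dsum]; exact C.deg u

theorem Part.ne3 (C : Ctx H k) {a b c : V} {M : Multiset (Multiset V)}
    (h : Part H ({a} + {b} + {c}) M) : (A H a b || A H a c || A H b c) = true := by
  by_contra hc
  simp only [Bool.or_eq_true, not_or, Bool.not_eq_true] at hc
  exact C.ne _ ((h.perm (zero_add _).symm).push hc.1.1 hc.1.2 hc.2)

theorem Part.ne6 (C : Ctx H k) {a b c d f g : V} {M : Multiset (Multiset V)}
    (h : Part H ({a} + {b} + {c} + {d} + {f} + {g}) M) :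
    (A H a b || A H a c || A H b c || (A H d f || A H d g || A H f g)) = true := by
  by_contra hc
  rw [Bool.or_eq_true, not_or] at hc
  have h1 := hc.1
  simp only [Bool.or_eq_true, not_or, Bool.not_eq_true] at h1
  have h2 : Part H ({d} + {f} + {g} + ({a} + {b} + {c})) M := h.perm (by abel)
  exact hc.2 ((h2.push h1.1.1 h1.1.2 h1.2).ne3 C)

theorem Part.ne9 (C : Ctx H k) {a b c d f g l m n : V} {M : Multiset (Multiset V)}
    (h : Part H ({a} + {b} + {c} + {d} + {f} + {g} + {l} + {m} + {n}) M) :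
    (A H a b || A H a c || A H b c || (A H d f || A H d g || A H f g ||
      (A H l m || A H l n || A H m n))) = true := by
  by_contra hc
  rw [Bool.or_eq_true, not_or] at hc
  have h1 := hc.1
  simp only [Bool.or_eq_true, not_or, Bool.not_eq_true] at h1
  have h2 : Part H ({d} + {f} + {g} + {l} + {m} + {n} + ({a} + {b} + {c})) M := h.perm (by abel)
  exact hc.2 ((h2.push h1.1.1 h1.1.2 h1.2).ne6 C)

theorem Part.ne12 (C : Ctx H k) {a b c d f g l m n o p q : V} {M : Multiset (Multiset V)}
    (h : Part H ({a} + {b} + {c} + {d} + {f} + {g} + {l} + {m} + {n} + {o} + {p} + {q}) M) :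
    (A H a b || A H a c || A H b c || (A H d f || A H d g || A H f g ||
      (A H l m || A H l n || A H m n || (A H o p || A H o q || A H p q)))) = true := by
  by_contra hc
  rw [Bool.or_eq_true, not_or] at hc
  have h1 := hc.1
  simp only [Bool.or_eq_true, not_or, Bool.not_eq_true] at h1
  have h2 : Part H ({d} + {f} + {g} + {l} + {m} + {n} + {o} + {p} + {q} + ({a} + {b} + {c})) M :=
    h.perm (by abel)
  exact hc.2 ((h2.push h1.1.1 h1.1.2 h1.2).ne9 C)

theorem Part.use6 (C : Ctx H k) {s : Multiset V} {M : Multiset (Multiset V)}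
    (h : Part H s M) (a b c d f g : V) (hs : s = {a} + {b} + {c} + {d} + {f} + {g}) :
    (A H a b || A H a c || A H b c || (A H d f || A H d g || A H f g)) = true :=
  Part.ne6 C (h.perm hs)

theorem Part.use9 (C : Ctx H k) {s : Multiset V} {M : Multiset (Multiset V)}
    (h : Part H s M) (a b c d f g l m n : V)
    (hs : s = {a} + {b} + {c} + {d} + {f} + {g} + {l} + {m} + {n}) :
    (A H a b || A H a c || A H b c || (A H d f || A H d g || A H f g ||
      (A H l m || A H l n || A H m n))) = true :=
  Part.ne9 C (h.perm hs)

theorem Part.use12 (C : Ctx H k) {s : Multiset V} {M : Multiset (Multiset V)}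
    (h : Part H s M) (a b c d f g l m n o p q : V)
    (hs : s = {a} + {b} + {c} + {d} + {f} + {g} + {l} + {m} + {n} + {o} + {p} + {q}) :
    (A H a b || A H a c || A H b c || (A H d f || A H d g || A H f g ||
      (A H l m || A H l n || A H m n || (A H o p || A H o q || A H p q)))) = true :=
  Part.ne12 C (h.perm hs)

end part
end EqCol

namespace EqCol

/-- a partition with one bad class `x z y` having the single edge `xz` -/
structure OC {V : Type*} [Fintype V] (H : SimpleGraph V) (x z y : V)
    (M : Multiset (Multiset V)) : Prop where
  part : Part H ({x} + {z} + {y}) M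
  xz : A H x z = true
  xy : A H x y = false
  zy : A H z y = false

/-- nearly equitable colouring, with a class of size two and a class of size four -/
structure NC {V : Type*} [Fintype V] (H : SimpleGraph V) (x y p q r s : V)
    (M : Multiset (Multiset V)) : Prop where
  part : Part H ({x} + {y} + {p} + {q} + {r} + {s}) M
  xy : A H x y = false
  pq : A H p q = false
  pr : A H p r = false
  ps : A H p s = false
  qr : A H q r = false
  qs : A H q s = false
  rs : A H r s = false

section step1
variable {V : Type*} [Fintype V] {H : SimpleGraph V} {k : ℕ}

theorem OC.swap {x z y : V} {M : Multiset (Multiset V)} (h : OC H x z y M) : OC H z x y M :=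
  ⟨h.part.perm (by abel), by rw [A_comm]; exact h.xz, h.zy, h.xy⟩

theorem OC.e1 (C : Ctx H k) (hN : ∀ x y p q r s M, ¬ NC H x y p q r s M)
    {x z y : V} {M : Multiset (Multiset V)} (h : OC H x z y M) : ∀ T ∈ M, e H x T = 1 := by
  have h0 : ∀ T ∈ M, 1 ≤ e H x T := by
    intro T hT
    by_contra hc
    obtain ⟨a, b, c, rfl, h1, h2, h3⟩ := sort_e0 (h.part.ok T hT) x (by omega)
    have ht := tri_bits (h.part.ok _ hT)
    obtain ⟨M', rfl⟩ := Multiset.exists_cons_of_mem hT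
    exact hN z y x a b c M' ⟨h.part.pull.perm (by abel), h.zy, h1, h2, h3, ht.1, ht.2.1, ht.2.2⟩
  intro T hT
  have h1 := h0 T hT
  obtain ⟨M', rfl⟩ := Multiset.exists_cons_of_mem hT
  have h2 := sum_ge (H := H) M' 1 1 0 0 0 x x x x fun T hT => by
    have := h0 T (Multiset.mem_cons_of_mem hT); omega
  have h3 := h.part.deg C x
  have h4 := h.part.cardeq C
  simp only [e_add, e_single, A_self, h.xz, h.xy, S_cons, Bool.toNat_true, Bool.toNat_false] at h3
  simp at h4
  omega

theorem OC.noy (C : Ctx H k) (hN : ∀ x y p q r s M, ¬ NC H x y p q r s M)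
    {x z y a b c : V} {M : Multiset (Multiset V)} (h : OC H x z y (({a} + {b} + {c}) ::ₘ M))
    (hx : A H x a = true) (hz : A H z a = true) : A H a y = false := by
  by_contra hy
  simp only [Bool.not_eq_false] at hy
  have h1 := h.e1 C hN _ (Multiset.mem_cons_self _ _)
  have ht := tri_bits (h.part.ok _ (Multiset.mem_cons_self _ _))
  rw [e3, hx] at h1
  have hb : A H x b = false := by
    revert h1; cases A H x b <;> cases A H x c <;> simp
  have hc : A H x c = false := by
    revert h1; cases A H x b <;> cases A H x c <;> simp
  have hP : Part H ({a} + {z} + {y}) (({x} + {b} + {c}) ::ₘ M) :=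
    Part.push (h.part.pull.perm (by abel)) hb hc ht.2.2
  have h3 := hP.deg C a
  have h4 := hP.cardeq C
  have hx' := hx; have hz' := hz
  rw [A_comm] at hx' hz'
  have h5 : ∃ T ∈ M, e H a T = 0 := by
    by_contra hcon
    push Not at hcon
    have h2 := sum_ge (H := H) M 1 1 0 0 0 a a a a fun T hT => by
      have := hcon T hT; omega
    simp only [e_add, e_single, A_self, hz', hy, hx', S_cons, Bool.toNat_true,
      Bool.toNat_false] at h3
    simp at h4
    omega
  obtain ⟨T, hT, h6⟩ := h5
  obtain ⟨d, f, g, rfl, g1, g2, g3⟩ := sort_e0 (h.part.ok T (Multiset.mem_cons_of_mem hT)) a h6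
  obtain ⟨M', rfl⟩ := Multiset.exists_cons_of_mem hT
  have ht' := tri_bits (h.part.ok _ (Multiset.mem_cons_of_mem hT))
  rw [Multiset.cons_swap] at hP
  exact hN z y a d f g _ ⟨hP.pull.perm (by abel), h.zy, g1, g2, g3, ht'.1, ht'.2.1, ht'.2.2⟩

theorem OC.clauses (C : Ctx H k) {x z y a b c : V} {M : Multiset (Multiset V)}
    (h : OC H x z y (({a} + {b} + {c}) ::ₘ M)) :
    (A H x b || A H x c || (A H z a || A H y a)) = true ∧
    (A H x a || A H x c || (A H z b || A H y b)) = true ∧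
    (A H x a || A H x b || (A H z c || A H y c)) = true ∧
    (A H z b || A H z c || (A H x a || A H y a)) = true ∧
    (A H z a || A H z c || (A H x b || A H y b)) = true ∧
    (A H z a || A H z b || (A H x c || A H y c)) = true := by
  have hP := h.part.pull
  obtain ⟨t1, t2, t3⟩ := tri_bits (h.part.ok _ (Multiset.mem_cons_self _ _))
  have t2' := t2; have t1' := t1; have t3' := t3
  rw [A_comm] at t1' t2' t3'
  have xy := h.xy
  have zy := h.zy
  refine ⟨?_, ?_, ?_, ?_, ?_, ?_⟩
  · have := hP.use6 C x b c z y a (by abel)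
    simp only [t3, zy, Bool.or_false, Bool.false_or] at this; exact this
  · have := hP.use6 C x a c z y b (by abel)
    simp only [t2, zy, Bool.or_false, Bool.false_or] at this; exact this
  · have := hP.use6 C x a b z y c (by abel)
    simp only [t1, zy, Bool.or_false, Bool.false_or] at this; exact this
  · have := hP.use6 C z b c x y a (by abel)
    simp only [t3, xy, Bool.or_false, Bool.false_or] at this; exact this
  · have := hP.use6 C z a c x y b (by abel)
    simp only [t2, xy, Bool.or_false, Bool.false_or] at this; exact this
  · have := hP.use6 C z a b x y c (by abel)
    simp only [t1, xy, Bool.or_false, Bool.false_or] at this; exact this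

theorem OC.same (C : Ctx H k) (hN : ∀ x y p q r s M, ¬ NC H x y p q r s M)
    {x z y a b c : V} {M : Multiset (Multiset V)} (h : OC H x z y (({a} + {b} + {c}) ::ₘ M))
    (hy : e H y ({a} + {b} + {c}) = 1) :
    A H x a = A H z a ∧ A H x b = A H z b ∧ A H x c = A H z c := by
  have h1 := h.e1 C hN _ (Multiset.mem_cons_self _ _)
  have h2 := h.swap.e1 C hN _ (Multiset.mem_cons_self _ _)
  rw [e3] at h1 h2 hy
  obtain ⟨c1, c2, c3, c4, c5, c6⟩ := h.clauses C
  have key : ∀ xa xb xc za zb zc ya yb yc : Bool,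
      xa.toNat + xb.toNat + xc.toNat = 1 → za.toNat + zb.toNat + zc.toNat = 1 →
      ya.toNat + yb.toNat + yc.toNat = 1 →
      (xb || xc || (za || ya)) = true → (xa || xc || (zb || yb)) = true →
      (xa || xb || (zc || yc)) = true → (zb || zc || (xa || ya)) = true →
      (za || zc || (xb || yb)) = true → (za || zb || (xc || yc)) = true →
      xa = za ∧ xb = zb ∧ xc = zc := by decide +kernel
  exact key _ _ _ _ _ _ _ _ _ h1 h2 hy c1 c2 c3 c4 c5 c6

theorem OC.noC5 (C : Ctx H k) (hN : ∀ x y p q r s M, ¬ NC H x y p q r s M)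
    (hcol : H.Colorable k)
    {x z y a b c : V} {M : Multiset (Multiset V)} (h : OC H x z y (({a} + {b} + {c}) ::ₘ M))
    (hxa : A H x a = true) (hxb : A H x b = false) (hxc : A H x c = false)
    (hza : A H z a = false) (hzb : A H z b = true) (hzc : A H z c = false) : False := by
  obtain ⟨c1, c2, c3, c4, c5, c6⟩ := h.clauses C
  obtain ⟨t1, t2, t3⟩ := tri_bits (h.part.ok _ (Multiset.mem_cons_self _ _))
  simp only [hxb, hxc, hza, hzc, Bool.or_false, Bool.false_or] at c1 c5
  have hP := h.part.pull
  have t3' := t3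
  have hxa' := hxa
  have hxb' := hxb
  have hzc' := hzc
  have hza' := hza
  have xy' := h.xy
  have zy' := h.zy
  have t1' := t1
  rw [A_comm] at t3' hxa' hxb' hza' hzc' xy' t1' zy'
  have o1 : OC H y a z (({x} + {b} + {c}) ::ₘ M) :=
    ⟨Part.push (hP.perm (by abel)) hxb hxc t3, c1, zy', hza'⟩
  have hyc : A H y c = false := by
    have := o1.e1 C hN _ (Multiset.mem_cons_self _ _)
    rw [e3, c5] at this
    revert this
    cases A H y c <;> simp
  have o2 : OC H z b a (({x} + {y} + {c}) ::ₘ M) :=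
    ⟨Part.push (hP.perm (by abel)) h.xy hxc hyc, hzb, hza, t1'⟩
  have o3 : OC H b y x (({z} + {a} + {c}) ::ₘ M) :=
    ⟨Part.push (hP.perm (by abel)) hza hzc t2, by rw [A_comm]; exact c5, hxb', xy'⟩
  by_cases hM : M = 0
  · subst hM
    have h4 := h.part.cardeq C
    simp at h4
    have hk : k = 2 := by omega
    subst hk
    obtain ⟨f⟩ := hcol
    have f1 := f.valid (A_iff.1 h.xz)
    have f2 := f.valid (A_iff.1 hzb)
    have f3 := f.valid (A_iff.1 c5)
    have f4 := f.valid (A_iff.1 c1)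
    have f5 := f.valid (A_iff.1 hxa)
    omega
  · obtain ⟨T, hT⟩ := Multiset.exists_mem_of_ne_zero hM
    obtain ⟨M', rfl⟩ := Multiset.exists_cons_of_mem hT
    rw [Multiset.cons_swap] at h o1 o2 o3
    have hTr := h.part.ok T (Multiset.mem_cons_self _ _)
    obtain ⟨d, f, g, rfl⟩ := tri_exists hTr
    have ey := o1.e1 C hN _ (Multiset.mem_cons_self _ _)
    have ea := o1.swap.e1 C hN _ (Multiset.mem_cons_self _ _)
    have ex := h.e1 C hN _ (Multiset.mem_cons_self _ _)
    have s1 := h.same C hN ey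
    have s2 := o2.same C hN ea
    have s3 := o3.same C hN ex
    have n1 : A H x d = true → False := fun hd => by
      have := h.noy C hN hd (by rw [← s1.1, hd])
      rw [A_comm, ← s3.1, ← s2.1, ← s1.1, hd] at this
      cases this
    have h' : OC H x z y (({f} + {g} + {d}) ::ₘ ({a} + {b} + {c}) ::ₘ M') := by
      have e1 : ({d} + {f} + {g} : Multiset V) = {f} + {g} + {d} := by abel
      rw [← e1]; exact h
    have h'' : OC H x z y (({g} + {d} + {f}) ::ₘ ({a} + {b} + {c}) ::ₘ M') := by
      have e1 : ({d} + {f} + {g} : Multiset V) = {g} + {d} + {f} := by abel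
      rw [← e1]; exact h
    have n2 : A H x f = true → False := fun hd => by
      have := h'.noy C hN hd (by rw [← s1.2.1, hd])
      rw [A_comm, ← s3.2.1, ← s2.2.1, ← s1.2.1, hd] at this
      cases this
    have n3 : A H x g = true → False := fun hd => by
      have := h''.noy C hN hd (by rw [← s1.2.2, hd])
      rw [A_comm, ← s3.2.2, ← s2.2.2, ← s1.2.2, hd] at this
      cases this
    rw [e3] at ex
    simp only [Bool.eq_false_iff.2 n1, Bool.eq_false_iff.2 n2, Bool.eq_false_iff.2 n3] at ex
    simp at ex

/-- in the absence of nearly equitable colourings, bad edges lie in triangles with every class -/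
theorem OC.tri (C : Ctx H k) (hN : ∀ x y p q r s M, ¬ NC H x y p q r s M)
    (hcol : H.Colorable k)
    {x z y : V} {M : Multiset (Multiset V)} (h : OC H x z y M) :
    ∀ T ∈ M, ∃ a b c, T = {a} + {b} + {c} ∧ A H x a = true ∧ A H x b = false ∧ A H x c = false ∧
      A H z a = true ∧ A H z b = false ∧ A H z c = false := by
  intro T hT
  obtain ⟨a, b, c, rfl, h1, h2, h3⟩ := sort_e1 (h.part.ok T hT) x (h.e1 C hN T hT)
  obtain ⟨M', rfl⟩ := Multiset.exists_cons_of_mem hT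
  have hz := h.swap.e1 C hN _ (Multiset.mem_cons_self _ _)
  rw [e3] at hz
  cases ha : A H z a <;> cases hb : A H z b <;> cases hc : A H z c <;> rw [ha, hb, hc] at hz <;>
    simp at hz
  · exfalso
    have e1 : ({a} + {b} + {c} : Multiset V) = {a} + {c} + {b} := by abel
    rw [e1] at h
    exact h.noC5 C hN hcol h1 h3 h2 ha hc hb
  · exact (h.noC5 C hN hcol h1 h2 h3 ha hb hc).elim
  · exact ⟨a, b, c, rfl, h1, h2, h3, ha, hb, hc⟩

theorem Part.cover {s : Multiset V} {M : Multiset (Multiset V)} (h : Part H s M) (v : V) :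
    v ∈ s ∨ ∃ T ∈ M, v ∈ T := by
  have : v ∈ s + M.sum := by rw [h.sum]; exact Finset.mem_univ v
  rcases Multiset.mem_add.1 this with h | h
  · exact Or.inl h
  · right
    clear this
    rename_i hP
    clear hP
    induction M using Multiset.induction with
    | empty => simp at h
    | cons T M ih =>
      rw [Multiset.sum_cons, Multiset.mem_add] at h
      rcases h with h | h
      · exact ⟨T, Multiset.mem_cons_self _ _, h⟩
      · obtain ⟨U, hU, hv⟩ := ih h
        exact ⟨U, Multiset.mem_cons_of_mem hU, hv⟩

theorem OC.twins (C : Ctx H k) (hN : ∀ x y p q r s M, ¬ NC H x y p q r s M)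
    (hcol : H.Colorable k)
    {x z y : V} {M : Multiset (Multiset V)} (h : OC H x z y M) (v : V) (hx : v ≠ x) (hz : v ≠ z) :
    A H x v = A H z v := by
  rcases h.part.cover v with hv | ⟨T, hT, hv⟩
  · simp only [Multiset.mem_add, Multiset.mem_singleton] at hv
    rcases hv with (rfl | rfl) | rfl
    · exact absurd rfl hx
    · exact absurd rfl hz
    · rw [h.xy, h.zy]
  · obtain ⟨a, b, c, rfl, h1, h2, h3, h4, h5, h6⟩ := h.tri C hN hcol T hT
    simp only [Multiset.mem_add, Multiset.mem_singleton] at hv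
    rcases hv with (rfl | rfl) | rfl
    · rw [h1, h4]
    · rw [h2, h5]
    · rw [h3, h6]

theorem deg_eq (u : V) [DecidableRel H.Adj] :
    e H u (Finset.univ : Finset V).val = H.degree u := by
  rw [← SimpleGraph.card_neighborFinset_eq_degree, SimpleGraph.neighborFinset_eq_filter,
    Finset.card_filter]
  show (∑ v, (A H u v).toNat) = _
  refine Finset.sum_congr rfl fun v _ => ?_
  by_cases h : H.Adj u v <;> simp [A, h]

theorem OC.existsNC (C : Ctx H k) (hcol : H.Colorable k)
    {x z y : V} {M : Multiset (Multiset V)} (h : OC H x z y M) :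
    ∃ x y p q r s M, NC H x y p q r s M := by
  classical
  by_contra hN
  push Not at hN
  -- every neighbour of `z` has the same closed neighbourhood as `z`
  have key : ∀ w, A H w z = true → ∃ y' M', OC H w z y' M' := by
    intro w hw
    rcases h.part.cover w with hv | ⟨T, hT, hv⟩
    · simp only [Multiset.mem_add, Multiset.mem_singleton] at hv
      rcases hv with (rfl | rfl) | rfl
      · exact ⟨y, M, h⟩
      · rw [A_self] at hw; cases hw
      · rw [A_comm, h.zy] at hw; cases hw
    · obtain ⟨a, b, c, rfl, h1, h2, h3, h4, h5, h6⟩ := h.tri C hN hcol T hT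
      obtain ⟨M', rfl⟩ := Multiset.exists_cons_of_mem hT
      obtain ⟨t1, t2, t3⟩ := tri_bits (h.part.ok _ (Multiset.mem_cons_self _ _))
      simp only [Multiset.mem_add, Multiset.mem_singleton] at hv
      rcases hv with (rfl | rfl) | rfl
      · refine ⟨y, (({x} + {b} + {c}) ::ₘ M'), ?_, hw, h.noy C hN h1 h4, h.zy⟩
        exact Part.push (h.part.pull.perm (by abel)) h2 h3 t3
      · rw [A_comm, h5] at hw; cases hw
      · rw [A_comm, h6] at hw; cases hw
  have hcl : H.IsNClique (k + 1) (insert z (H.neighborFinset z)) := by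
    rw [SimpleGraph.isNClique_iff]
    constructor
    · intro u hu v hv huv
      simp only [Finset.coe_insert, SimpleGraph.coe_neighborFinset, Set.mem_insert_iff,
        SimpleGraph.mem_neighborSet] at hu hv
      by_cases huz : u = z
      · subst huz
        rcases hv with rfl | hv
        · exact absurd rfl huv
        · exact hv
      · by_cases hvz : v = z
        · subst hvz
          exact (hu.resolve_left huz).symm
        · have hu' := hu.resolve_left huz
          have hv' := hv.resolve_left hvz
          obtain ⟨y', M', ho⟩ := key u (A_iff.2 hu'.symm)
          have := ho.twins C hN hcol v huv.symm hvz
          exact A_iff.1 (this.trans (A_iff.2 hv'))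
    · rw [Finset.card_insert_of_notMem (by simp), SimpleGraph.card_neighborFinset_eq_degree,
        ← deg_eq, ← h.part.dsum]
      have h1 : S H z M = Multiset.card M := by
        have h0 := h.swap.e1 C hN
        clear h key
        induction M using Multiset.induction with
        | empty => simp [S]
        | cons T M ih =>
          rw [S_cons, h0 T (Multiset.mem_cons_self _ _),
            ih fun T hT => h0 T (Multiset.mem_cons_of_mem hT), Multiset.card_cons]
          omega
      have h4 := h.part.cardeq C
      have hxz := h.xz
      rw [A_comm] at hxz
      simp only [e_add, e_single, A_self, hxz, h.zy, Bool.toNat_true, Bool.toNat_false]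
      simp at h4
      omega
  exact (hcol.cliqueFree (Nat.lt_succ_self k)) _ hcl

end step1
end EqCol

namespace EqCol

/-- the basic configuration: centre `x`, leaves `p q r`, and an edge `y s` -/
structure MC {V : Type*} [Fintype V] (H : SimpleGraph V) (x y p q r s : V)
    (M : Multiset (Multiset V)) : Prop extends NC H x y p q r s M where
  xp : A H x p = true
  xq : A H x q = true
  xr : A H x r = true
  xs : A H x s = false
  yp : A H y p = false
  yq : A H y q = false
  yr : A H y r = false
  ys : A H y s = true

section step2
variable {V : Type*} [Fintype V] {H : SimpleGraph V} {k : ℕ}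

set_option synthInstance.maxHeartbeats 400000 in
set_option synthInstance.maxSize 2000 in
theorem m1_key : ∀ xa xb xc ya yb yc pa pb pc sa sb sc : Bool,
    (xb || xc || (pa || sa)) = true → (xa || xc || (pb || sb)) = true →
    (xa || xb || (pc || sc)) = true → (pb || pc || (xa || sa)) = true →
    (pa || pc || (xb || sb)) = true → (pa || pb || (xc || sc)) = true →
    (yb || yc || (sa || xa)) = true → (ya || yc || (sb || xb)) = true →
    (ya || yb || (sc || xc)) = true → (sb || sc || (ya || xa)) = true →
    (sa || sc || (yb || xb)) = true → (sa || sb || (yc || xc)) = true →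
    (pb || pc || (xa || ya)) = true →
    (pa || pc || (xb || yb)) = true →
    (pa || pb || (xc || yc)) = true →
    6 ≤ 2 * (xa.toNat + xb.toNat + xc.toNat) + 1 * (ya.toNat + yb.toNat + yc.toNat)
      + 2 * (pa.toNat + pb.toNat + pc.toNat) + 1 * (sa.toNat + sb.toNat + sc.toNat) := by
  decide +kernel

theorem NC.noM1 (C : Ctx H k) {x y p q r s : V} {M : Multiset (Multiset V)}
    (h : NC H x y p q r s M) (xp : A H x p = true) (xq : A H x q = true) (xr : A H x r = true)
    (xs : A H x s = false) (yp : A H y p = true) (yq : A H y q = false) (yr : A H y r = false)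
    (ys : A H y s = true) : False := by
  have yq' := yq; have yr' := yr; have xp' := xp; have yp' := yp; have ys' := ys
  have sx := xs; have yx := h.xy
  rw [A_comm] at yq' yr' xp' yp' ys' sx yx
  have key : ∀ T ∈ M, 6 ≤ 2 * e H x T + 1 * e H y T + 2 * e H p T + 1 * e H s T := by
    intro T hT
    have hTr := h.part.ok T hT
    obtain ⟨a, b, c, rfl⟩ := tri_exists hTr
    obtain ⟨t1, t2, t3⟩ := tri_bits hTr
    obtain ⟨M', rfl⟩ := Multiset.exists_cons_of_mem hT
    have o1 : OC H x p s (({a} + {b} + {c}) ::ₘ ({q} + {r} + {y}) ::ₘ M') := by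
      refine ⟨?_, xp, xs, h.ps⟩
      rw [Multiset.cons_swap]
      exact Part.push (h.part.perm (by abel)) h.qr yq' yr'
    have o2 : OC H y s x (({a} + {b} + {c}) ::ₘ ({p} + {q} + {r}) ::ₘ M') := by
      refine ⟨?_, ys, yx, sx⟩
      rw [Multiset.cons_swap]
      exact Part.push (h.part.perm (by abel)) h.pq h.pr h.qr
    have hP : Part H ({x} + {y} + {p} + {a} + {b} + {c}) (({q} + {r} + {s}) ::ₘ M') :=
      Part.push (h.part.pull.perm (by abel)) h.qr h.qs h.rs
    obtain ⟨c1, c2, c3, c4, c5, c6⟩ := o1.clauses C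
    obtain ⟨d1, d2, d3, d4, d5, d6⟩ := o2.clauses C
    have e1 := hP.use6 C p b c x y a (by abel)
    have e2 := hP.use6 C p a c x y b (by abel)
    have e3' := hP.use6 C p a b x y c (by abel)
    simp only [t1, t2, t3, h.xy, Bool.or_false, Bool.false_or] at e1 e2 e3'
    simp only [e3]
    exact m1_key _ _ _ _ _ _ _ _ _ _ _ _ c1 c2 c3 c4 c5 c6 d1 d2 d3 d4 d5 d6 e1 e2 e3'
  have hs := sum_ge M 6 2 1 2 1 x y p s key
  have g1 := h.part.deg C x
  have g2 := h.part.deg C y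
  have g3 := h.part.deg C p
  have g4 := h.part.deg C s
  have g5 := h.part.cardeq C
  simp only [e_add, e_single, A_self, h.xy, xp, xq, xr, xs, Bool.toNat_true,
      Bool.toNat_false] at g1
  simp only [e_add, e_single, A_self, yp, ys, Bool.toNat_true,
      Bool.toNat_false] at g2
  simp only [e_add, e_single, A_self, xp', yp', Bool.toNat_true,
      Bool.toNat_false] at g3
  simp only [e_add, e_single, A_self, ys', Bool.toNat_true,
      Bool.toNat_false] at g4
  simp at g5
  omega

set_option synthInstance.maxHeartbeats 400000 in
set_option synthInstance.maxSize 2000 in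
/-- key fact -/
theorem OC.low (C : Ctx H k) {x p y : V} {M : Multiset (Multiset V)} {T : Multiset V}
    (h : OC H x p y (T ::ₘ M)) (h1 : e H x T + e H p T ≤ 1) :
    e H x T = 0 ∧ e H p T = 0 ∧ e H y T = 3 ∧
      ∃ a b c, MC H y x a b c p M := by
  have hTr := h.part.ok T (Multiset.mem_cons_self _ _)
  have yx := h.xy; have yp := h.zy
  rw [A_comm] at yx yp
  have hx : e H x T ≠ 1 := by
    intro hx
    obtain ⟨a, b, c, rfl, xa, xb, xc⟩ := sort_e1 hTr x hx
    have hp : e H p ({a} + {b} + {c}) = 0 := by omega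
    obtain ⟨t1, t2, t3⟩ := tri_bits hTr
    obtain ⟨c1, c2, c3, c4, c5, c6⟩ := h.clauses C
    rw [e3] at hp
    have key : ∀ xa xb xc pa pb pc ya yb yc : Bool, xa = true → xb = false → xc = false →
      pa.toNat + pb.toNat + pc.toNat = 0 →
      (xb || xc || (pa || ya)) = true → 
      (pa || pc || (xb || yb)) = true → (pa || pb || (xc || yc)) = true →
      pa = false ∧ pb = false ∧ pc = false ∧ ya = true ∧ yb = true ∧ yc = true := by decide +kernel
    obtain ⟨pa, pb, pc, ya, yb, yc⟩ := key _ _ _ _ _ _ _ _ _ xa xb xc hp c1 c5 c6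
    refine NC.noM1 C (x := y) (y := x) (p := a) (q := b) (r := c) (s := p) (M := M)
      ⟨h.part.pull.perm (by abel), yx, t1, t2, ?_, t3, ?_, ?_⟩ ya yb yc yp xa xb xc h.xz
    all_goals rw [A_comm]; assumption
  have hp : e H p T ≠ 1 := by
    intro hp
    obtain ⟨a, b, c, rfl, pa, pb, pc⟩ := sort_e1 hTr p hp
    have hx : e H x ({a} + {b} + {c}) = 0 := by omega
    obtain ⟨t1, t2, t3⟩ := tri_bits hTr
    obtain ⟨c1, c2, c3, c4, c5, c6⟩ := h.swap.clauses C
    rw [e3] at hx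
    have key : ∀ xa xb xc pa pb pc ya yb yc : Bool, xa = true → xb = false → xc = false →
      pa.toNat + pb.toNat + pc.toNat = 0 →
      (xb || xc || (pa || ya)) = true → 
      (pa || pc || (xb || yb)) = true → (pa || pb || (xc || yc)) = true →
      pa = false ∧ pb = false ∧ pc = false ∧ ya = true ∧ yb = true ∧ yc = true := by decide +kernel
    obtain ⟨xa, xb, xc, ya, yb, yc⟩ := key _ _ _ _ _ _ _ _ _ pa pb pc hx c1 c5 c6
    refine NC.noM1 C (x := y) (y := p) (p := a) (q := b) (r := c) (s := x) (M := M)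
      ⟨h.part.pull.perm (by abel), yp, t1, t2, ?_, t3, ?_, ?_⟩ ya yb yc yx pa pb pc h.swap.xz
    all_goals rw [A_comm]; assumption
  have hx0 : e H x T = 0 := by omega
  have hp0 : e H p T = 0 := by omega
  refine ⟨hx0, hp0, ?_⟩
  obtain ⟨a, b, c, rfl⟩ := tri_exists hTr
  obtain ⟨t1, t2, t3⟩ := tri_bits hTr
  obtain ⟨c1, c2, c3, c4, c5, c6⟩ := h.clauses C
  rw [e3] at hp0 hx0
  have key : ∀ xa xb xc pa pb pc ya yb yc : Bool, xa.toNat + xb.toNat + xc.toNat = 0 →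
      pa.toNat + pb.toNat + pc.toNat = 0 →
      (xb || xc || (pa || ya)) = true → 
      (pa || pc || (xb || yb)) = true → (pa || pb || (xc || yc)) = true →
      (xa = false ∧ xb = false ∧ xc = false) ∧
      pa = false ∧ pb = false ∧ pc = false ∧ ya = true ∧ yb = true ∧ yc = true := by decide +kernel
  obtain ⟨⟨xa, xb, xc⟩, pa, pb, pc, ya, yb, yc⟩ := key _ _ _ _ _ _ _ _ _ hx0 hp0 c1 c5 c6
  refine ⟨by rw [e3, ya, yb, yc]; rfl, a, b, c, ⟨h.part.pull.perm (by abel), yx, t1, t2, ?_, t3,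
    ?_, ?_⟩, ya, yb, yc, yp, xa, xb, xc, h.xz⟩
  all_goals rw [A_comm]; assumption

/-- star pattern -/
theorem NC.star (C : Ctx H k) {x y p q r s : V} {M : Multiset (Multiset V)}
    (h : NC H x y p q r s M) (xp : A H x p = true) (xq : A H x q = true) (xr : A H x r = true)
    (xs : A H x s = true) (ys : A H y s = false) : ∃ x y p q r s M, MC H x y p q r s M := by
  have sx := xs; have sy := ys
  rw [A_comm] at sx sy
  have o : OC H x s y (({p} + {q} + {r}) ::ₘ M) :=
    ⟨Part.push (h.part.perm (by abel)) h.pq h.pr h.qr, xs, h.xy, sy⟩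
  by_contra hc
  have key : ∀ T ∈ M, 2 ≤ 1 * e H x T + 1 * e H s T + 0 * e H s T + 0 * e H s T := by
    intro T hT
    by_contra hlt
    obtain ⟨M', rfl⟩ := Multiset.exists_cons_of_mem hT
    rw [Multiset.cons_swap] at o
    obtain ⟨_, _, _, a, b, c, hm⟩ := o.low C (by omega)
    exact hc ⟨_, _, _, _, _, _, _, hm⟩
  have hs := sum_ge M 2 1 1 0 0 x s s s key
  have g1 := h.part.deg C x
  have g2 := h.part.deg C s
  have g5 := h.part.cardeq C
  simp only [e_add, e_single, A_self, h.xy, xp, xq, xr, xs, Bool.toNat_true,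
      Bool.toNat_false] at g1
  simp only [e_add, e_single, A_self, sx, Bool.toNat_true,
      Bool.toNat_false] at g2
  simp at g5
  omega

theorem NC.swap {x y p q r s : V} {M : Multiset (Multiset V)}
    (h : NC H x y p q r s M) : NC H y x p q r s M :=
  ⟨h.part.perm (by abel), by rw [A_comm]; exact h.xy, h.pq, h.pr, h.ps, h.qr, h.qs, h.rs⟩

/-- rotation of the four vertices -/
theorem NC.rot {x y p q r s : V} {M : Multiset (Multiset V)}
    (h : NC H x y p q r s M) : NC H x y q r s p M :=
  ⟨h.part.perm (by abel), h.xy, h.qr, h.qs, by rw [A_comm]; exact h.pq, h.rs,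
    by rw [A_comm]; exact h.pr, by rw [A_comm]; exact h.ps⟩

/-- transposition of the first two vertices -/
theorem NC.tr {x y p q r s : V} {M : Multiset (Multiset V)}
    (h : NC H x y p q r s M) : NC H x y q p r s M :=
  ⟨h.part.perm (by abel), h.xy, by rw [A_comm]; exact h.pq, h.qr, h.qs, h.pr, h.ps, h.rs⟩

/-- transposition of the middle two vertices -/
theorem NC.tr2 {x y p q r s : V} {M : Multiset (Multiset V)}
    (h : NC H x y p q r s M) : NC H x y p r q s M :=
  ⟨h.part.perm (by abel), h.xy, h.pr, h.pq, h.ps, by rw [A_comm]; exact h.qr, h.rs, h.qs⟩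

theorem NC.two_aux (C : Ctx H k) (hno : ¬ ∃ x y p q r s M, MC H x y p q r s M)
    {x y p q r s : V} {M : Multiset (Multiset V)}
    (h : NC H x y p q r s M) (xr : A H x r = true) (yr : A H y r = false)
    (T : Multiset V) (hT : T ∈ M) (hx : e H x T = 0) (hr : e H r T = 2) (hy : e H y T ≤ 1) :
    False := by
  have hTr := h.part.ok T hT
  obtain ⟨M', rfl⟩ := Multiset.exists_cons_of_mem hT
  obtain ⟨a, b, c, rfl, ra, rb, rc⟩ := sort_e2 hTr r hr
  obtain ⟨t1, t2, t3⟩ := tri_bits hTr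
  have ry := yr
  have rx := xr
  have yx := h.xy
  rw [A_comm] at ry rx yx
  have o : OC H x r y (({a} + {b} + {c}) ::ₘ ({p} + {q} + {s}) ::ₘ M') := by
    refine ⟨?_, xr, h.xy, ry⟩
    rw [Multiset.cons_swap]
    exact Part.push (h.part.perm (by abel)) h.pq h.ps h.qs
  obtain ⟨c1, c2, c3, c4, c5, c6⟩ := o.clauses C
  rw [e3] at hx hy
  have key : ∀ xa xb xc rc ya yb yc : Bool, xa.toNat + xb.toNat + xc.toNat = 0 →
      ya.toNat + yb.toNat + yc.toNat ≤ 1 → rc = false → 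
      (xa || xb || (rc || yc)) = true →
      xa = false ∧ xb = false ∧ xc = false ∧ ya = false ∧ yb = false ∧ yc = true := by
    decide +kernel
  obtain ⟨xa, xb, xc, ya, yb, yc⟩ := key _ _ _ _ _ _ _ hx hy rc c3
  have hP := o.part.pull
  exact hno ⟨r, y, x, a, b, c, _, ⟨hP.perm (by abel), ry, xa, xb, xc, t1, t2, t3⟩,
    rx, ra, rb, rc, yx, ya, yb, yc⟩

theorem NC.two (C : Ctx H k)
    {x y p q r s : V} {M : Multiset (Multiset V)}
    (h : NC H x y p q r s M) (xp : A H x p = true) (xq : A H x q = true) (xr : A H x r = true)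
    (xs : A H x s = false)
    (yp : A H y p = true) (yq : A H y q = true) (yr : A H y r = false) (ys : A H y s = true) :
    ∃ x y p q r s M, MC H x y p q r s M := by
  by_contra hno
  have sx := xs; have ry := yr; have rx := xr; have sy := ys; have yx := h.xy; have sr := h.rs
  rw [A_comm] at sx ry rx sy yx sr
  have o1 : OC H x r y (({p} + {q} + {s}) ::ₘ M) :=
    ⟨Part.push (h.part.perm (by abel)) h.pq h.ps h.qs, xr, h.xy, ry⟩
  have o2 : OC H y s x (({p} + {q} + {r}) ::ₘ M) :=
    ⟨Part.push (h.part.perm (by abel)) h.pq h.pr h.qr, ys, yx, sx⟩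
  have k1 : ∀ T ∈ M, 2 ≤ 1 * e H x T + 1 * e H r T + 0 * e H s T + 0 * e H s T := by
    intro T hT
    by_contra hlt
    obtain ⟨M', rfl⟩ := Multiset.exists_cons_of_mem hT
    rw [Multiset.cons_swap] at o1
    obtain ⟨_, _, _, a, b, c, hm⟩ := o1.low C (by omega)
    exact hno ⟨_, _, _, _, _, _, _, hm⟩
  have k2 : ∀ T ∈ M, 2 ≤ 1 * e H y T + 1 * e H s T + 0 * e H s T + 0 * e H s T := by
    intro T hT
    by_contra hlt
    obtain ⟨M', rfl⟩ := Multiset.exists_cons_of_mem hT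
    rw [Multiset.cons_swap] at o2
    obtain ⟨_, _, _, a, b, c, hm⟩ := o2.low C (by omega)
    exact hno ⟨_, _, _, _, _, _, _, hm⟩
  have g1 := h.part.deg C x
  have g2 := h.part.deg C r
  have g3 := h.part.deg C y
  have g4 := h.part.deg C s
  have g5 := h.part.cardeq C
  simp only [e_add, e_single, A_self, h.xy, xp, xq, xr, xs, Bool.toNat_true,
      Bool.toNat_false] at g1
  simp only [e_add, e_single, A_self, rx, ry, Bool.toNat_true,
      Bool.toNat_false] at g2
  simp only [e_add, e_single, A_self, yx, yp, yq, yr, ys, Bool.toNat_true,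
      Bool.toNat_false] at g3
  simp only [e_add, e_single, A_self, sy, Bool.toNat_true,
      Bool.toNat_false] at g4
  simp at g5
  have hex : ∃ T ∈ M, e H x T + e H y T ≤ 1 := by
    by_contra hcon
    push Not at hcon
    have := sum_ge (H := H) M 2 1 1 0 0 x y y y fun T hT => by
      have := hcon T hT; omega
    omega
  obtain ⟨T, hT, hxy⟩ := hex
  have q1 := k1 T hT
  have q2 := k2 T hT
  have q3 : e H x T + e H r T ≤ 2 ∧ e H y T + e H s T ≤ 2 := by
    obtain ⟨M', rfl⟩ := Multiset.exists_cons_of_mem hT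
    have r1 := sum_ge (H := H) M' 2 1 1 0 0 x r s s
      fun T hT => k1 T (Multiset.mem_cons_of_mem hT)
    have r2 := sum_ge (H := H) M' 2 1 1 0 0 y s s s
      fun T hT => k2 T (Multiset.mem_cons_of_mem hT)
    simp only [S_cons, Multiset.card_cons] at g1 g2 g3 g4 g5
    constructor <;> omega
  by_cases hx : e H x T = 0
  · exact h.two_aux C hno xr yr T hT hx (by omega) (by omega)
  · have h' : NC H y x p q s r M :=
      ⟨h.part.perm (by abel), yx, h.pq, h.ps, h.pr, h.qs, h.qr, sr⟩
    exact h'.two_aux C hno ys xs T hT (by omega) (by omega) (by omega)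

theorem NC.full_aux (C : Ctx H k)
    {x y p q r s : V} {M : Multiset (Multiset V)}
    (h : NC H x y p q r s M) (xp : A H x p = true) (xq : A H x q = true) (xr : A H x r = true)
    (xs : A H x s = true)
    (T : Multiset V) (hT : T ∈ M) (hy : e H y T = 0) (hx : e H x T + e H p T ≤ 2) :
    ∃ x y p q r s M, MC H x y p q r s M := by
  have hTr := h.part.ok T hT
  obtain ⟨M', rfl⟩ := Multiset.exists_cons_of_mem hT
  have main : ∀ a b c, T = {a} + {b} + {c} → A H x a = false → A H p a = false →
      ∃ x y p q r s M, MC H x y p q r s M := by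
    rintro a b c rfl xa pa
    obtain ⟨t1, t2, t3⟩ := tri_bits hTr
    rw [e3] at hy
    have key : ∀ ya yb yc : Bool, ya.toNat + yb.toNat + yc.toNat = 0 → yb = false ∧ yc = false := by
      decide +kernel
    obtain ⟨yb, yc⟩ := key _ _ _ hy
    have h' : NC H x a q r s p (({y} + {b} + {c}) ::ₘ M') :=
      ⟨Part.push (h.part.pull.perm (by abel)) yb yc t3, xa, h.rot.pq, h.rot.pr, h.rot.ps,
        h.rot.qr, h.rot.qs, h.rot.rs⟩
    exact h'.star C xq xr xs xp (by rw [A_comm]; exact pa)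
  obtain ⟨a, b, c, hTe⟩ := tri_exists hTr
  have hx' := hx
  rw [hTe, e3, e3] at hx'
  have key : ∀ xa xb xc pa pb pc : Bool,
      xa.toNat + xb.toNat + xc.toNat + (pa.toNat + pb.toNat + pc.toNat) ≤ 2 →
      (xa = false ∧ pa = false) ∨ (xb = false ∧ pb = false) ∨ (xc = false ∧ pc = false) := by
    decide +kernel
  rcases key _ _ _ _ _ _ hx' with h1 | h1 | h1
  · exact main a b c hTe h1.1 h1.2
  · exact main b a c (by rw [hTe]; abel) h1.1 h1.2
  · exact main c a b (by rw [hTe]; abel) h1.1 h1.2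

theorem full_key : ∀ xa xb xc ya yb yc : Bool,
      xa.toNat + xb.toNat + xc.toNat + (ya.toNat + yb.toNat + yc.toNat) ≤ 2 →
      (xa || ya) = true → (xb || yb) = true → (xc || yc) = true → False := by
    decide +kernel

theorem NC.full (C : Ctx H k)
    {x y p q r s : V} {M : Multiset (Multiset V)}
    (h : NC H x y p q r s M) (xp : A H x p = true) (xq : A H x q = true) (xr : A H x r = true)
    (xs : A H x s = true) (yp : A H y p = true) (yq : A H y q = true) (yr : A H y r = true)
    (ys : A H y s = true) :
    ∃ x y p q r s M, MC H x y p q r s M := by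
  have px := xp; have py := yp; have yx := h.xy
  rw [A_comm] at px py yx
  have g1 := h.part.deg C x
  have g2 := h.part.deg C p
  have g3 := h.part.deg C y
  have g5 := h.part.cardeq C
  simp only [e_add, e_single, A_self, h.xy, xp, xq, xr, xs, Bool.toNat_true,
      Bool.toNat_false] at g1
  simp only [e_add, e_single, A_self, px, py, Bool.toNat_true,
      Bool.toNat_false] at g2
  simp only [e_add, e_single, A_self, yx, yp, yq, yr, ys, Bool.toNat_true,
      Bool.toNat_false] at g3
  simp at g5
  have hex : ∃ T ∈ M, e H x T + e H y T + e H p T ≤ 2 := by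
    by_contra hcon
    push Not at hcon
    have := sum_ge (H := H) M 3 1 1 1 0 x y p y fun T hT => by
      have := hcon T hT; omega
    omega
  obtain ⟨T, hT, hxy⟩ := hex
  by_cases hy : e H y T = 0
  · exact h.full_aux C xp xq xr xs T hT hy (by omega)
  by_cases hx : e H x T = 0
  · exact h.swap.full_aux C yp yq yr ys T hT hx (by omega)
  exfalso
  have hp : e H p T = 0 := by omega
  have hTr := h.part.ok T hT
  obtain ⟨M', rfl⟩ := Multiset.exists_cons_of_mem hT
  obtain ⟨a, b, c, rfl, pa, pb, pc⟩ := sort_e0 hTr p hp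
  obtain ⟨t1, t2, t3⟩ := tri_bits hTr
  have hP := h.part.pull
  have e1 := hP.use9 C p b c x y a q r s (by abel)
  have e2 := hP.use9 C p a c x y b q r s (by abel)
  have e4 := hP.use9 C p a b x y c q r s (by abel)
  simp only [pa, pb, pc, t1, t2, t3, h.xy, h.qr, h.qs, h.rs, Bool.or_false,
    Bool.false_or] at e1 e2 e4
  rw [e3] at hxy hx hy hp
  rw [e3] at hxy
  rw [e3, pa, pb, pc] at hxy
  exact full_key _ _ _ _ _ _ (by simpa using hxy) e1 e2 e4

/-- sorted case: `x` is adjacent to the first three -/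
theorem NC.three (C : Ctx H k)
    {x y p q r s : V} {M : Multiset (Multiset V)}
    (h : NC H x y p q r s M) (xp : A H x p = true) (xq : A H x q = true) (xr : A H x r = true) :
    ∃ x y p q r s M, MC H x y p q r s M := by
  have e1 := h.part.use6 C x y s p q r (by abel)
  simp only [h.xy, h.pq, h.pr, h.qr, Bool.or_false, Bool.false_or] at e1
  have h1 : NC H x y q p r s M := h.tr
  have h2 : NC H x y p r q s M := h.tr2
  have yx := h.xy
  rw [A_comm] at yx
  cases xs : A H x s
  · rw [xs, Bool.false_or] at e1
    cases yp : A H y p <;> cases yq : A H y q <;> cases yr : A H y r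
    · exact ⟨x, y, p, q, r, s, M, h, xp, xq, xr, xs, yp, yq, yr, e1⟩
    · exact (h2.tr.noM1 C xr xp xq xs yr yp yq e1).elim
    · exact (h1.noM1 C xq xp xr xs yq yp yr e1).elim
    · exact h1.tr2.two C xq xr xp xs yq yr yp e1
    · exact (h.noM1 C xp xq xr xs yp yq yr e1).elim
    · exact h2.two C xp xr xq xs yp yr yq e1
    · exact h.two C xp xq xr xs yp yq yr e1
    · exact h.swap.star C yp yq yr e1 xs
  · by_cases yp : A H y p = false
    · exact h.rot.star C xq xr xs xp yp
    by_cases yq : A H y q = false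
    · exact h1.rot.star C xp xr xs xq yq
    by_cases yr : A H y r = false
    · exact h2.tr.rot.star C xp xq xs xr yr
    by_cases ys : A H y s = false
    · exact h.star C xp xq xr xs ys
    simp only [Bool.not_eq_false] at yp yq yr ys
    exact h.full C xp xq xr xs yp yq yr ys

set_option synthInstance.maxHeartbeats 400000 in
set_option synthInstance.maxSize 2000 in
theorem NC.toMC (C : Ctx H k)
    {x y p q r s : V} {M : Multiset (Multiset V)} (h : NC H x y p q r s M) :
    ∃ x y p q r s M, MC H x y p q r s M := by
  have e1 := h.part.use6 C x y s p q r (by abel)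
  have e2 := h.part.use6 C x y p q r s (by abel)
  have e3 := h.part.use6 C x y q p r s (by abel)
  have e4 := h.part.use6 C x y r p q s (by abel)
  have f1 := h.part.use6 C x p q y r s (by abel)
  have f2 := h.part.use6 C x p r y q s (by abel)
  have f3 := h.part.use6 C x p s y q r (by abel)
  have f4 := h.part.use6 C x q r y p s (by abel)
  have f5 := h.part.use6 C x q s y p r (by abel)
  have f6 := h.part.use6 C x r s y p q (by abel)
  simp only [h.xy, h.pq, h.pr, h.qr, h.ps, h.qs, h.rs, Bool.or_false, Bool.false_or] at e1 e2 e3 e4 f1 f2 f3 f4 f5 f6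
  have key : ∀ xp xq xr xs yp yq yr ys : Bool, (xs || ys) = true → (xp || yp) = true →
      (xq || yq) = true → (xr || yr) = true → (xp || xq || (yr || ys)) = true →
      (xp || xr || (yq || ys)) = true → (xp || xs || (yq || yr)) = true →
      (xq || xr || (yp || ys)) = true → (xq || xs || (yp || yr)) = true →
      (xr || xs || (yp || yq)) = true →
      (xp && xq && xr || xq && xr && xs || xr && xs && xp || xs && xp && xq ||
      (yp && yq && yr || yq && yr && ys || yr && ys && yp || ys && yp && yq)) = true := by
    decide +kernel
  have hk := key _ _ _ _ _ _ _ _ e1 e2 e3 e4 f1 f2 f3 f4 f5 f6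
  simp only [Bool.or_eq_true, Bool.and_eq_true] at hk
  rcases hk with (((hk | hk) | hk) | hk) | (((hk | hk) | hk) | hk)
  · exact h.three C hk.1.1 hk.1.2 hk.2
  · exact h.rot.three C hk.1.1 hk.1.2 hk.2
  · exact h.rot.rot.three C hk.1.1 hk.1.2 hk.2
  · exact h.rot.rot.rot.three C hk.1.1 hk.1.2 hk.2
  · exact h.swap.three C hk.1.1 hk.1.2 hk.2
  · exact h.swap.rot.three C hk.1.1 hk.1.2 hk.2
  · exact h.swap.rot.rot.three C hk.1.1 hk.1.2 hk.2
  · exact h.swap.rot.rot.rot.three C hk.1.1 hk.1.2 hk.2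

end step2
end EqCol

namespace EqCol

section step3
variable {V : Type*} [Fintype V] {H : SimpleGraph V} {k : ℕ}

theorem e3_zero {u a b c : V} (h : e H u ({a} + {b} + {c}) = 0) :
    A H u a = false ∧ A H u b = false ∧ A H u c = false := by
  rw [e3] at h; revert h
  cases A H u a <;> cases A H u b <;> cases A H u c <;> simp

theorem e3_three {u a b c : V} (h : e H u ({a} + {b} + {c}) = 3) :
    A H u a = true ∧ A H u b = true ∧ A H u c = true := by
  rw [e3] at h; revert h
  cases A H u a <;> cases A H u b <;> cases A H u c <;> simp

theorem tri_mem {T : Multiset V} (h : Tri H T) {v : V} (hv : v ∈ T) :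
    ∃ a b, T = {a} + {b} + {v} := by
  obtain ⟨a, b, c, rfl⟩ := tri_exists h
  simp only [Multiset.mem_add, Multiset.mem_singleton] at hv
  rcases hv with (rfl | rfl) | rfl
  · exact ⟨b, c, by abel⟩
  · exact ⟨a, c, by abel⟩
  · exact ⟨a, b, rfl⟩

variable {x y p q r s : V} {M : Multiset (Multiset V)}

/-- exchange the two ends of the extra edge -/
theorem MC.sw (h : MC H x y p q r s M) : MC H x s p q r y M where
  part := h.part.perm (by abel)
  xy := h.xs
  pq := h.pq
  pr := h.pr
  ps := by rw [A_comm]; exact h.yp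
  qr := h.qr
  qs := by rw [A_comm]; exact h.yq
  rs := by rw [A_comm]; exact h.yr
  xp := h.xp
  xq := h.xq
  xr := h.xr
  xs := h.xy
  yp := by rw [A_comm]; exact h.ps
  yq := by rw [A_comm]; exact h.qs
  yr := by rw [A_comm]; exact h.rs
  ys := by rw [A_comm]; exact h.ys

theorem MC.lt (h : MC H x y p q r s M) : MC H x y q p r s M :=
  ⟨h.toNC.tr, h.xq, h.xp, h.xr, h.xs, h.yq, h.yp, h.yr, h.ys⟩

theorem MC.lt2 (h : MC H x y p q r s M) : MC H x y p r q s M :=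
  ⟨h.toNC.tr2, h.xp, h.xr, h.xq, h.xs, h.yp, h.yr, h.yq, h.ys⟩

theorem MC.rev (h : MC H x y p q r s M) : MC H x y r q p s M := h.lt.lt2.lt

theorem MC.oc1 (h : MC H x y p q r s M) : OC H x p y (({q} + {r} + {s}) ::ₘ M) :=
  ⟨Part.push (h.part.perm (by abel)) h.qr h.qs h.rs, h.xp, h.xy, by rw [A_comm]; exact h.yp⟩

theorem MC.oc2 (h : MC H x y p q r s M) : OC H y s x (({p} + {q} + {r}) ::ₘ M) :=
  ⟨Part.push (h.part.perm (by abel)) h.pq h.pr h.qr, h.ys, by rw [A_comm]; exact h.xy,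
    by rw [A_comm]; exact h.xs⟩

theorem MC.degs (C : Ctx H k) (h : MC H x y p q r s M) :
    3 + S H x M ≤ k ∧ 1 + S H p M ≤ k ∧ 1 + S H y M ≤ k ∧ 1 + S H s M ≤ k ∧
      Multiset.card M + 2 = k := by
  have g1 := h.part.deg C x
  have g2 := h.part.deg C p
  have g3 := h.part.deg C y
  have g4 := h.part.deg C s
  have g5 := h.part.cardeq C
  have px := h.xp; have sy := h.ys
  rw [A_comm] at px sy
  simp only [e_add, e_single, A_self, h.xy, h.xp, h.xq, h.xr, h.xs, Bool.toNat_true,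
      Bool.toNat_false] at g1
  simp only [e_add, e_single, A_self, px, Bool.toNat_true,
      Bool.toNat_false] at g2
  simp only [e_add, e_single, A_self, h.ys, Bool.toNat_true,
      Bool.toNat_false] at g3
  simp only [e_add, e_single, A_self, sy, Bool.toNat_true,
      Bool.toNat_false] at g4
  simp at g5
  omega

theorem MC.a1 (C : Ctx H k) (h : MC H x y p q r s M) {T : Multiset V} (hT : T ∈ M) :
    2 ≤ e H x T + e H p T ∨ (e H x T = 0 ∧ e H p T = 0 ∧ e H y T = 3 ∧ e H s T = 3) := by
  by_cases hlt : 2 ≤ e H x T + e H p T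
  · exact Or.inl hlt
  right
  have o1 := h.oc1
  have o2 := h.sw.oc1
  obtain ⟨M', rfl⟩ := Multiset.exists_cons_of_mem hT
  rw [Multiset.cons_swap] at o1 o2
  have h1 := o1.low C (by omega)
  have h2 := o2.low C (by omega)
  exact ⟨h1.1, h1.2.1, h1.2.2.1, h2.2.2.1⟩

theorem MC.a2 (C : Ctx H k) (h : MC H x y p q r s M) {T : Multiset V} (hT : T ∈ M) :
    2 ≤ e H y T + e H s T ∨ (e H y T = 0 ∧ e H s T = 0 ∧ e H x T = 3) := by
  by_cases hlt : 2 ≤ e H y T + e H s T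
  · exact Or.inl hlt
  right
  have o1 := h.oc2
  obtain ⟨M', rfl⟩ := Multiset.exists_cons_of_mem hT
  rw [Multiset.cons_swap] at o1
  have h1 := o1.low C (by omega)
  exact ⟨h1.1, h1.2.1, h1.2.2.1⟩

theorem MC.val (C : Ctx H k) (h : MC H x y p q r s M) {T : Multiset V} (hT : T ∈ M) :
    2 * e H x T + 2 * e H p T + e H y T + e H s T ≤ 8 := by
  have key : ∀ T ∈ M, 6 ≤ 2 * e H x T + 2 * e H p T + 1 * e H y T + 1 * e H s T := by
    intro T hT
    have h1 := h.a1 C hT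
    have h2 := h.a2 C hT
    omega
  have hd := h.degs C
  obtain ⟨M', rfl⟩ := Multiset.exists_cons_of_mem hT
  have := sum_ge M' 6 2 2 1 1 x p y s fun T hT => key T (Multiset.mem_cons_of_mem hT)
  simp only [S_cons, Multiset.card_cons] at hd
  omega

theorem MC.nob (C : Ctx H k) (h : MC H x y p q r s M) {T : Multiset V} (hT : T ∈ M) :
    2 ≤ e H x T + e H p T := by
  rcases h.a1 C hT with h1 | ⟨hx, hp, hy, hs⟩
  · exact h1
  exfalso
  have hd := h.degs C
  have hTr := h.part.ok T hT
  obtain ⟨M', rfl⟩ := Multiset.exists_cons_of_mem hT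
  have hex : ∃ T' ∈ M', e H y T' + e H s T' < 2 := by
    by_contra hcon
    push Not at hcon
    have := sum_ge (H := H) M' 2 1 1 0 0 y s y y fun T hT => by
      have := hcon T hT; omega
    simp only [S_cons, Multiset.card_cons] at hd
    omega
  obtain ⟨T', hT', hlt⟩ := hex
  have hT'M : T' ∈ T ::ₘ M' := Multiset.mem_cons_of_mem hT'
  have hTr' := h.part.ok T' hT'M
  rcases h.a2 C hT'M with h2 | ⟨gy, gs, gx⟩
  · omega
  have hv := h.val C hT'M
  obtain ⟨d, f, g, rfl, h3, h4, h5⟩ := sort_e hTr' p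
  obtain ⟨a, b, c, rfl⟩ := tri_exists hTr
  obtain ⟨t1, t2, t3⟩ := tri_bits hTr
  obtain ⟨t4, t5, t6⟩ := tri_bits hTr'
  obtain ⟨yd, yf, yg⟩ := e3_zero gy
  obtain ⟨sd, sf, sg⟩ := e3_zero gs
  obtain ⟨xd, xf, xg⟩ := e3_three gx
  obtain ⟨xa, xb, xc⟩ := e3_zero hx
  obtain ⟨pa, pb, pc⟩ := e3_zero hp
  obtain ⟨M'', rfl⟩ := Multiset.exists_cons_of_mem hT'
  have hP : Part H ({x} + {y} + {p} + {q} + {r} + {s} + ({d} + {f} + {g}))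
      (({a} + {b} + {c}) ::ₘ M'') := by
    have := h.part
    rw [Multiset.cons_swap] at this
    exact this.pull
  have pg : A H p g = false := by
    have hle : e H p ({d} + {f} + {g}) ≤ 1 := by omega
    rw [e3] at hle
    revert h3 h4 h5 hle
    cases A H p d <;> cases A H p f <;> cases A H p g <;> simp
  have hm : MC H x y g d f s (({p} + {q} + {r}) ::ₘ ({a} + {b} + {c}) ::ₘ M'') := by
    refine ⟨⟨Part.push (hP.perm (by abel)) h.pq h.pr h.qr, h.xy, ?_, ?_, ?_, t4, ?_, ?_⟩, xg, xd, xf,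
      h.xs, yg, yd, yf, h.ys⟩
    all_goals rw [A_comm]; assumption
  have hTm : ({a} + {b} + {c}) ∈ (({p} + {q} + {r}) ::ₘ ({a} + {b} + {c}) ::ₘ M'') :=
    Multiset.mem_cons_of_mem (Multiset.mem_cons_self _ _)
  have w1 := hm.a1 C hTm
  have w2 := hm.val C hTm
  have hg : e H g ({a} + {b} + {c}) = 0 := by omega
  obtain ⟨ga, gb, gc⟩ := e3_zero hg
  have hP' := h.part.pull.pull
  have e1 := hP'.use12 C x a b y d f p g c q r s (by abel)
  simp only [xa, xb, t1, yd, yf, t4, pg, pc, gc, h.qr, h.qs, h.rs, Bool.or_false] at e1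
  cases e1

theorem MC.main (C : Ctx H k) (h : MC H x y p q r s M) {T : Multiset V} (hT : T ∈ M) :
    e H x T + e H p T = 2 ∧ e H x T + e H q T = 2 ∧ e H x T + e H r T = 2 ∧
      2 ≤ e H y T + e H s T ∧ e H y T + e H s T ≤ 4 := by
  have key : ∀ {p q r : V}, MC H x y p q r s M → e H x T + e H p T = 2 := by
    intro p q r h
    have h1 := h.nob C hT
    have hd := h.degs C
    obtain ⟨M', rfl⟩ := Multiset.exists_cons_of_mem hT
    have := sum_ge (H := H) M' 2 1 1 0 0 x p x x fun T hT => by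
      have := h.nob C (Multiset.mem_cons_of_mem hT); omega
    simp only [S_cons, Multiset.card_cons] at hd
    omega
  have h1 := key h
  have h2 := key h.lt
  have h3 := key h.rev
  have h4 := h.val C hT
  have h5 := h.a2 C hT
  omega

theorem MC.z_imp (C : Ctx H k) (h : MC H x y p q r s M) {T : Multiset V} (hT : T ∈ M)
    (hx : e H x T = 0) {v : V} (hv : v ∈ T) (hp : A H p v = false) : A H y v = true := by
  have hTr := h.part.ok T hT
  obtain ⟨a, b, rfl⟩ := tri_mem hTr hv
  obtain ⟨M', rfl⟩ := Multiset.exists_cons_of_mem hT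
  obtain ⟨t1, t2, t3⟩ := tri_bits hTr
  obtain ⟨xa, xb, xv⟩ := e3_zero hx
  have e1 := h.part.pull.use9 C x a b y p v q r s (by abel)
  simp only [xa, xb, t1, h.yp, hp, h.qr, h.qs, h.rs, Bool.or_false, Bool.false_or] at e1
  exact e1

theorem MC.h_imp (C : Ctx H k) (h : MC H x y p q r s M) {T : Multiset V} (hT : T ∈ M)
    (hp : e H p T = 0) {v : V} (hv : v ∈ T) (hx : A H x v = false) : A H y v = true := by
  have hTr := h.part.ok T hT
  obtain ⟨a, b, rfl⟩ := tri_mem hTr hv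
  obtain ⟨M', rfl⟩ := Multiset.exists_cons_of_mem hT
  obtain ⟨t1, t2, t3⟩ := tri_bits hTr
  obtain ⟨pa, pb, pv⟩ := e3_zero hp
  have e1 := h.part.pull.use9 C p a b x y v q r s (by abel)
  simp only [pa, pb, t1, h.xy, hx, h.qr, h.qs, h.rs, Bool.or_false, Bool.false_or] at e1
  exact e1

/-- the swapped nearly equitable colouring at a class without neighbours of the centre -/
theorem MC.znc {a b c : V}
    (h : MC H x y p q r s (({a} + {b} + {c}) ::ₘ M)) (hx : e H x ({a} + {b} + {c}) = 0) :
    NC H p y x a b c (({q} + {r} + {s}) ::ₘ M) := by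
  obtain ⟨t1, t2, t3⟩ := tri_bits (h.part.ok _ (Multiset.mem_cons_self _ _))
  obtain ⟨xa, xb, xc⟩ := e3_zero hx
  exact ⟨Part.push (h.part.pull.perm (by abel)) h.qr h.qs h.rs, by rw [A_comm]; exact h.yp,
    xa, xb, xc, t1, t2, t3⟩

theorem MC.hnc {a b c : V}
    (h : MC H x y p q r s (({a} + {b} + {c}) ::ₘ M)) (hp : e H p ({a} + {b} + {c}) = 0) :
    NC H x y p a b c (({q} + {r} + {s}) ::ₘ M) := by
  obtain ⟨t1, t2, t3⟩ := tri_bits (h.part.ok _ (Multiset.mem_cons_self _ _))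
  obtain ⟨pa, pb, pc⟩ := e3_zero hp
  exact ⟨Part.push (h.part.pull.perm (by abel)) h.qr h.qs h.rs, h.xy,
    pa, pb, pc, t1, t2, t3⟩

theorem MC.zodd (C : Ctx H k) (h : MC H x y p q r s M) {T : Multiset V} (hT : T ∈ M)
    (hx : e H x T = 0) : e H y T = 1 ∨ e H y T = 3 := by
  have hTr := h.part.ok T hT
  have hp : e H p T = 2 := by have := h.main C hT; omega
  obtain ⟨a, b, c, rfl, pa, pb, pc⟩ := sort_e2 hTr p hp
  have yc := h.z_imp C hT hx (v := c) (by simp) pc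
  obtain ⟨M', rfl⟩ := Multiset.exists_cons_of_mem hT
  have hn := h.znc hx
  have px := h.xp; have yx := h.xy
  rw [A_comm] at px yx
  rw [e3, yc]
  cases ya : A H y a <;> cases yb : A H y b
  · simp
  · exact (hn.rot.rot.rot.rot.tr2.tr.noM1 C pb px pa pc yb yx ya yc).elim
  · exact (hn.tr.noM1 C pa px pb pc ya yx yb yc).elim
  · simp

theorem MC.hodd (C : Ctx H k) (h : MC H x y p q r s M) {T : Multiset V} (hT : T ∈ M)
    (hx : e H x T = 2) : e H y T = 1 ∨ e H y T = 3 := by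
  have hTr := h.part.ok T hT
  have hp : e H p T = 0 := by have := h.main C hT; omega
  obtain ⟨a, b, c, rfl, xa, xb, xc⟩ := sort_e2 hTr x hx
  have yc := h.h_imp C hT hp (v := c) (by simp) xc
  obtain ⟨M', rfl⟩ := Multiset.exists_cons_of_mem hT
  have hn := h.hnc hp
  rw [e3, yc]
  cases ya : A H y a <;> cases yb : A H y b
  · simp
  · exact (hn.tr2.tr.noM1 C xb h.xp xa xc yb h.yp ya yc).elim
  · exact (hn.tr.noM1 C xa h.xp xb xc ya h.yp yb yc).elim
  · simp

/-- new configuration from a class of type Z -/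
theorem MC.zconf (C : Ctx H k) {a b c : V}
    (h : MC H x y p q r s (({a} + {b} + {c}) ::ₘ M)) (hx : e H x ({a} + {b} + {c}) = 0)
    (pa : A H p a = true) (pb : A H p b = true) (pc : A H p c = false)
    (hy : e H y ({a} + {b} + {c}) = 1) : MC H p y x a b c (({q} + {r} + {s}) ::ₘ M) := by
  have yc := h.z_imp C (Multiset.mem_cons_self _ _) hx (v := c) (by simp) pc
  have px := h.xp; have yx := h.xy
  rw [A_comm] at px yx
  rw [e3, yc] at hy
  have ya : A H y a = false := by
    revert hy; cases A H y a <;> simp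
  have yb : A H y b = false := by
    revert hy; cases A H y b <;> simp
  exact ⟨h.znc hx, px, pa, pb, pc, yx, ya, yb, yc⟩

/-- new configuration from a class of type H -/
theorem MC.hconf (C : Ctx H k) {a b c : V}
    (h : MC H x y p q r s (({a} + {b} + {c}) ::ₘ M)) (hp : e H p ({a} + {b} + {c}) = 0)
    (xa : A H x a = true) (xb : A H x b = true) (xc : A H x c = false)
    (hy : e H y ({a} + {b} + {c}) = 1) : MC H x y p a b c (({q} + {r} + {s}) ::ₘ M) := by
  have yc := h.h_imp C (Multiset.mem_cons_self _ _) hp (v := c) (by simp) xc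
  rw [e3, yc] at hy
  have ya : A H y a = false := by
    revert hy; cases A H y a <;> simp
  have yb : A H y b = false := by
    revert hy; cases A H y b <;> simp
  exact ⟨h.hnc hp, h.xp, xa, xb, xc, h.yp, ya, yb, yc⟩

end step3
end EqCol

namespace EqCol

section step3c
variable {V : Type*} [Fintype V] {H : SimpleGraph V} {k : ℕ}
variable {x y p q r s : V} {M : Multiset (Multiset V)}

theorem e3_eq {u a b c : V} {α β γ : Bool} (ha : A H u a = α) (hb : A H u b = β)
    (hc : A H u c = γ) : e H u ({a} + {b} + {c}) = α.toNat + β.toNat + γ.toNat := by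
  rw [e3, ha, hb, hc]

theorem MC.c5imp (C : Ctx H k) {a b c : V}
    (h : MC H x y p q r s (({a} + {b} + {c}) ::ₘ M))
    (xa : A H x a = true) (xb : A H x b = false) (xc : A H x c = false)
    (pa : A H p a = false) (pb : A H p b = true) (pc : A H p c = false) :
    A H y a = true ∧ A H y b = true := by
  have o := h.oc1
  rw [Multiset.cons_swap] at o
  obtain ⟨c1, c2, c3, c4, c5, c6⟩ := o.clauses C
  simp only [xa, xb, xc, pa, pb, pc, Bool.or_false, Bool.false_or, Bool.or_true, Bool.true_or] at *
  tauto

theorem c5key : ∀ ta tu tv bt bu bv : Bool,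
    (tv || (bt || bu)) = true → (bv || (ta || tu)) = true →
    2 ≤ ta.toNat + tu.toNat + tv.toNat + (bt.toNat + bu.toNat + bv.toNat) := by
  decide +kernel

theorem MC.noC5 (C : Ctx H k) {a b c : V}
    (h : MC H x y p q r s (({a} + {b} + {c}) ::ₘ M))
    (xa : A H x a = true) (xb : A H x b = false) (xc : A H x c = false)
    (pa : A H p a = false) (pb : A H p b = true) (pc : A H p c = false) : False := by
  obtain ⟨ya, yb⟩ := h.c5imp C xa xb xc pa pb pc
  obtain ⟨sa, sb⟩ := h.sw.c5imp C xa xb xc pa pb pc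
  obtain ⟨m1, m2, m3, m4, m5⟩ := h.main C (Multiset.mem_cons_self _ _)
  obtain ⟨tab, tac, tbc⟩ := tri_bits (h.part.ok _ (Multiset.mem_cons_self _ _))
  have yc : A H y c = false := by
    rw [e3, e3, ya, yb, sa, sb] at m5
    revert m5; cases A H y c <;> simp
    cases A H s c <;> simp
  have sc : A H s c = false := by
    rw [e3, e3, ya, yb, sa, sb] at m5
    revert m5; cases A H s c <;> simp
    omega
  have hd := h.degs C
  simp only [S_cons, Multiset.card_cons, e3, ya, yb, yc, sa, sb, sc, Bool.toNat_true, Bool.toNat_false] at hd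
  have two : ∀ T ∈ M, e H y T + e H s T = 2 := by
    intro T hT
    have g := h.main C (Multiset.mem_cons_of_mem hT)
    have hk : ∀ T ∈ M, 2 ≤ e H y T + e H s T := fun T hT =>
      (h.main C (Multiset.mem_cons_of_mem hT)).2.2.2.1
    obtain ⟨M', rfl⟩ := Multiset.exists_cons_of_mem hT
    have := sum_ge (H := H) M' 2 1 1 0 0 y s y y fun T hT => by
      have := hk T (Multiset.mem_cons_of_mem hT); omega
    simp only [S_cons, Multiset.card_cons] at hd
    omega
  have leafc : ∀ {q p' r : V}, MC H x y q p' r s (({a} + {b} + {c}) ::ₘ M) → A H q c = false ∧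
      (A H q a).toNat + (A H q b).toNat = 1 := by
    intro q p' r h
    have m := (h.main C (Multiset.mem_cons_self _ _)).1
    rw [e3, e3, xa, xb, xc] at m
    cases qc : A H q c
    · refine ⟨rfl, ?_⟩
      simp [qc] at m; omega
    · exfalso
      have qa : A H q a = false := by
        revert m; rw [qc]; cases A H q a <;> simp
        omega
      have qb : A H q b = false := by
        revert m; rw [qc]; cases A H q b <;> simp
        omega
      rw [show ({a} + {b} + {c} : Multiset V) = {a} + {c} + {b} by abel] at h
      have := (h.c5imp C xa xc xb qa qc qb).2
      rw [yc] at this; cases this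
  have hq := leafc h.lt
  have claim : ∀ T ∈ M, 2 ≤ e H a T + e H b T := by
    intro T hT
    have g := h.main C (Multiset.mem_cons_of_mem hT)
    have t2 := two T hT
    have hTr := h.part.ok T (Multiset.mem_cons_of_mem hT)
    have hx : e H x T = 0 ∨ e H x T = 1 ∨ e H x T = 2 := by omega
    rcases hx with hx | hx | hx
    · have hp : e H p T = 2 := by omega
      have hy := h.zodd C (Multiset.mem_cons_of_mem hT) hx
      have hy : e H y T = 1 := by omega
      obtain ⟨t, u, v, rfl, pt, pu, pv⟩ := sort_e2 hTr p hp
      obtain ⟨M', rfl⟩ := Multiset.exists_cons_of_mem hT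
      rw [Multiset.cons_swap] at h
      have z := h.zconf C hx pt pu pv hy
      rw [Multiset.cons_swap, show ({a} + {b} + {c} : Multiset V) = {b} + {a} + {c} by abel] at z
      obtain ⟨vb, va⟩ := z.sw.c5imp C pb pa pc xb xa xc
      rw [A_comm] at vb va
      rw [e3, e3, va, vb]; simp; omega
    · have hp : e H p T = 1 := by omega
      have hr : e H r T = 1 := by omega
      have hq' : e H q T = 1 := by omega
      obtain ⟨t, u, v, rfl, xt, xu, xv⟩ := sort_e1 hTr x hx
      obtain ⟨M', rfl⟩ := Multiset.exists_cons_of_mem hT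
      have h' := h
      rw [Multiset.cons_swap] at h'
      have leaf : ∀ {p q r : V}, MC H x y p q r s (({t} + {u} + {v}) ::ₘ ({a} + {b} + {c}) ::ₘ M') →
          A H p t = true ∧ A H p u = false ∧ A H p v = false := by
        intro p q r h
        have m := (h.main C (Multiset.mem_cons_self _ _)).1
        rw [e3, e3, xt, xu, xv] at m
        cases pt : A H p t <;> cases pu : A H p u <;> cases pv : A H p v <;> simp [pt, pu, pv] at m ⊢
        · rw [show ({t} + {u} + {v} : Multiset V) = {t} + {v} + {u} by abel] at h t2
          obtain ⟨yt, yv⟩ := h.c5imp C xt xv xu pt pv pu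
          obtain ⟨st, sv⟩ := h.sw.c5imp C xt xv xu pt pv pu
          rw [e3, e3, yt, yv, st, sv] at t2; simp at t2; omega
        · obtain ⟨yt, yv⟩ := h.c5imp C xt xu xv pt pu pv
          obtain ⟨st, sv⟩ := h.sw.c5imp C xt xu xv pt pu pv
          rw [e3, e3, yt, yv, st, sv] at t2; simp at t2; omega
      obtain ⟨pt, pu, pv⟩ := leaf h'
      obtain ⟨ttu, ttv, tuv⟩ := tri_bits hTr
      have P := h.part.pull.pull
      have yp := h.yp
      rw [A_comm] at yp
      have c1 := P.use12 C x y c p a v b t u q r s (by abel)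
      have c2 := P.use12 C x b v p y c a t u q r s (by abel)
      simp only [h.xy, xc, yc, pa, pv, ttu, h.qr, h.qs, h.rs, Bool.or_false, Bool.false_or] at c1
      simp only [xb, xv, yp, pc, yc, ttu, h.qr, h.qs, h.rs, Bool.or_false, Bool.false_or] at c2
      rw [e3, e3]
      exact c5key _ _ _ _ _ _ c1 c2
    · have hp : e H p T = 0 := by omega
      have hy := h.hodd C (Multiset.mem_cons_of_mem hT) hx
      have hy : e H y T = 1 := by omega
      obtain ⟨t, u, v, rfl, xt, xu, xv⟩ := sort_e2 hTr x hx
      obtain ⟨M', rfl⟩ := Multiset.exists_cons_of_mem hT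
      rw [Multiset.cons_swap] at h
      have z := h.hconf C hp xt xu xv hy
      rw [Multiset.cons_swap] at z
      obtain ⟨va, vb⟩ := z.sw.c5imp C xa xb xc pa pb pc
      rw [A_comm] at vb va
      rw [e3, e3, va, vb]; simp; omega
  have hs := sum_ge (H := H) M 2 1 1 0 0 a b a a fun T hT => by
    have := claim T hT; omega
  have da := h.part.deg C a
  have db := h.part.deg C b
  have qa := A_comm (H := H) a q
  have qb := A_comm (H := H) b q
  rw [A_comm] at xa pb ya yb sa sb
  simp only [e_add, e_single, S_cons, xa, ya, sa, pb, yb, sb, qa, qb, Bool.toNat_true] at da db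
  omega

theorem MC.leafa (C : Ctx H k) {a b c : V}
    (h : MC H x y p q r s (({a} + {b} + {c}) ::ₘ M))
    (xa : A H x a = true) (xb : A H x b = false) (xc : A H x c = false) :
    A H p a = true ∧ A H p b = false ∧ A H p c = false := by
  have m := (h.main C (Multiset.mem_cons_self _ _)).1
  rw [e3, e3, xa, xb, xc] at m
  cases pa : A H p a <;> cases pb : A H p b <;> cases pc : A H p c <;> simp [pa, pb, pc] at m ⊢
  · rw [show ({a} + {b} + {c} : Multiset V) = {a} + {c} + {b} by abel] at h
    exact h.noC5 C xa xc xb pa pc pb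
  · exact h.noC5 C xa xb xc pa pb pc

theorem MC.zA (C : Ctx H k) {a b c : V}
    (h : MC H x y p q r s (({a} + {b} + {c}) ::ₘ M))
    (xa : A H x a = true) (xb : A H x b = false) (xc : A H x c = false) {T : Multiset V}
    (hT : T ∈ M) (hx : e H x T = 0) : 2 ≤ e H a T := by
  have hT' := Multiset.mem_cons_of_mem (b := {a} + {b} + {c}) hT
  have key : ∀ {y s : V}, MC H x y p q r s (({a} + {b} + {c}) ::ₘ M) → e H y T = 1 →
      2 ≤ e H a T := by
    intro y s h hy
    obtain ⟨pa, pb, pc⟩ := h.leafa C xa xb xc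
    have hp : e H p T = 2 := by have := h.main C hT'; omega
    obtain ⟨t, u, v, rfl, pt, pu, pv⟩ := sort_e2 (h.part.ok _ hT') p hp
    obtain ⟨M', rfl⟩ := Multiset.exists_cons_of_mem hT
    rw [Multiset.cons_swap] at h
    have z := h.zconf C hx pt pu pv hy
    rw [Multiset.cons_swap] at z
    have ta := (z.lt.leafa C pa pb pc).1
    have ua := (z.rev.leafa C pa pb pc).1
    rw [A_comm] at ta ua
    rw [e3, ta, ua]; simp
  have o1 := h.zodd C hT' hx
  have o2 := h.sw.zodd C hT' hx
  have m := h.main C hT'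
  have : e H y T = 1 ∨ e H s T = 1 := by omega
  rcases this with h1 | h1
  · exact key h h1
  · exact key h.sw h1

theorem MC.claimA (C : Ctx H k) {a b c : V}
    (h : MC H x y p q r s (({a} + {b} + {c}) ::ₘ M))
    (xa : A H x a = true) (xb : A H x b = false) (xc : A H x c = false) {T : Multiset V}
    (hT : T ∈ M) : 3 ≤ e H a T + e H y T + e H s T := by
  have hT' := Multiset.mem_cons_of_mem (b := {a} + {b} + {c}) hT
  have m := h.main C hT'
  by_cases hx : e H x T = 0
  · have := h.zA C xa xb xc hT hx
    omega
  by_cases ha : e H a T = 0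
  swap
  · omega
  have key : ∀ {y s : V}, MC H x y p q r s (({a} + {b} + {c}) ::ₘ M) →
      3 ≤ e H p T + e H s T := by
    intro y s h
    obtain ⟨tab, tac, tbc⟩ := tri_bits (h.part.ok _ (Multiset.mem_cons_self _ _))
    have hTr := h.part.ok _ hT'
    obtain ⟨t, u, v, rfl⟩ := tri_exists hTr
    obtain ⟨ttu, ttv, tuv⟩ := tri_bits hTr
    obtain ⟨at', au, av⟩ := e3_zero ha
    obtain ⟨M', rfl⟩ := Multiset.exists_cons_of_mem hT
    have P := h.part.pull.pull
    have c1 := P.use12 C x b c y q r a t u p s v (by abel)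
    have c2 := P.use12 C x b c y q r a t v p s u (by abel)
    have c3 := P.use12 C x b c y q r a u v p s t (by abel)
    simp only [xb, xc, tbc, h.yq, h.yr, h.qr, at', au, av, ttu, ttv, tuv, h.ps,
      Bool.or_false, Bool.false_or] at c1 c2 c3
    rw [e3, e3]
    revert c1 c2 c3
    cases A H p t <;> cases A H p u <;> cases A H p v <;> cases A H s t <;> cases A H s u <;>
      cases A H s v <;> simp
  have k1 := key h
  have k2 := key h.sw
  omega

theorem MC.noE1 (C : Ctx H k) (h : MC H x y p q r s M) {T : Multiset V} (hT : T ∈ M)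
    (hx : e H x T = 1) : False := by
  obtain ⟨a, b, c, rfl, xa, xb, xc⟩ := sort_e1 (h.part.ok _ hT) x hx
  obtain ⟨M, rfl⟩ := Multiset.exists_cons_of_mem hT
  obtain ⟨pa, pb, pc⟩ := h.leafa C xa xb xc
  obtain ⟨qa, qb, qc⟩ := h.lt.leafa C xa xb xc
  obtain ⟨ra, rb, rc⟩ := h.rev.leafa C xa xb xc
  obtain ⟨tab, tac, tbc⟩ := tri_bits (h.part.ok _ (Multiset.mem_cons_self _ _))
  have hd := h.degs C
  simp only [S_cons, Multiset.card_cons] at hd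
  have hz : ∃ T ∈ M, e H x T = 0 := by
    by_contra hcon
    push Not at hcon
    have := sum_ge (H := H) M 1 1 0 0 0 x x x x fun T hT => by
      have := hcon T hT; omega
    omega
  obtain ⟨T2, hT2, hz⟩ := hz
  have hT2' := Multiset.mem_cons_of_mem (b := {a} + {b} + {c}) hT2
  have z := h.zA C xa xb xc hT2 hz
  have m1 := h.main C (Multiset.mem_cons_self _ _)
  have m2 := h.main C hT2'
  have ax := A_comm (H := H) a x
  have ap := A_comm (H := H) a p
  have aq := A_comm (H := H) a q
  have ar := A_comm (H := H) a r
  rw [xa] at ax; rw [pa] at ap; rw [qa] at aq; rw [ra] at ar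
  by_cases hi : A H a y = false ∧ A H a s = false
  · have hm : MC H a y p q r s (({x} + {b} + {c}) ::ₘ M) :=
      ⟨⟨Part.push (h.part.pull.perm (by abel)) xb xc tbc, hi.1, h.pq, h.pr, h.ps, h.qr, h.qs, h.rs⟩,
        ap, aq, ar, hi.2, h.yp, h.yq, h.yr, h.ys⟩
    have := hm.main C (Multiset.mem_cons_of_mem hT2)
    omega
  have da := h.part.deg C a
  have hi' : 1 ≤ (A H a y).toNat + (A H a s).toNat := by
    revert hi
    cases A H a y <;> cases A H a s <;> simp
  simp only [e_add, e_single, S_cons, ax, ap, aq, ar, Bool.toNat_true] at da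
  have ca : ∀ T ∈ M, 3 ≤ e H a T + e H y T + e H s T := fun T hT => h.claimA C xa xb xc hT
  obtain ⟨M', rfl⟩ := Multiset.exists_cons_of_mem hT2
  have := sum_ge (H := H) M' 3 1 1 1 0 a y s a fun T hT => by
    have := ca T (Multiset.mem_cons_of_mem hT); omega
  simp only [S_cons, Multiset.card_cons] at hd da
  omega

end step3c
end EqCol

namespace EqCol

section step3d
variable {V : Type*} [Fintype V] {H : SimpleGraph V} {k : ℕ}
variable {x y p q r s : V} {M : Multiset (Multiset V)}

theorem MC.types (C : Ctx H k) (h : MC H x y p q r s M) {T : Multiset V} (hT : T ∈ M) :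
    (e H x T = 0 ∨ e H x T = 2) ∧ e H y T = 1 ∧ e H s T = 1 := by
  have ty : ∀ T ∈ M, (e H x T = 0 ∨ e H x T = 2) := by
    intro T hT
    have m := h.main C hT
    have n : e H x T ≠ 1 := fun hx => h.noE1 C hT hx
    omega
  have one : ∀ {y s : V}, MC H x y p q r s M → ∀ T ∈ M, e H y T = 1 ∨ e H y T = 3 := by
    intro y s h T hT
    rcases ty T hT with h0 | h2
    · exact h.zodd C hT h0
    · exact h.hodd C hT h2
  have fin : ∀ {y s : V}, MC H x y p q r s M → e H y T = 1 := by
    intro y s h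
    have o := one h
    have hd := h.degs C
    have oT := o T hT
    obtain ⟨M', rfl⟩ := Multiset.exists_cons_of_mem hT
    have := sum_ge (H := H) M' 1 1 0 0 0 y y y y fun T hT => by
      have := o T (Multiset.mem_cons_of_mem hT); omega
    simp only [S_cons, Multiset.card_cons] at hd
    omega
  exact ⟨ty T hT, fin h, fin h.sw⟩

theorem MC.pz (C : Ctx H k) (h : MC H x y p q r s M) {T : Multiset V} (hT : T ∈ M)
    (hx : e H x T = 0) {v : V} (hv : v ∈ T) : A H p v = !A H y v := by
  obtain ⟨_, hy, _⟩ := h.types C hT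
  have hp : e H p T = 2 := by have := h.main C hT; omega
  obtain ⟨a, b, c, rfl, pa, pb, pc⟩ := sort_e2 (h.part.ok _ hT) p hp
  obtain ⟨M', rfl⟩ := Multiset.exists_cons_of_mem hT
  have z := h.zconf C hx pa pb pc hy
  simp only [Multiset.mem_add, Multiset.mem_singleton] at hv
  rcases hv with (rfl | rfl) | rfl
  · rw [pa, z.yq]; rfl
  · rw [pb, z.yr]; rfl
  · rw [pc, z.ys]; rfl

theorem MC.xh (C : Ctx H k) (h : MC H x y p q r s M) {T : Multiset V} (hT : T ∈ M)
    (hx : e H x T = 2) {v : V} (hv : v ∈ T) : A H p v = false ∧ A H x v = !A H y v := by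
  obtain ⟨_, hy, _⟩ := h.types C hT
  have hp : e H p T = 0 := by have := h.main C hT; omega
  obtain ⟨a, b, c, rfl, xa, xb, xc⟩ := sort_e2 (h.part.ok _ hT) x hx
  obtain ⟨M', rfl⟩ := Multiset.exists_cons_of_mem hT
  have z := h.hconf C hp xa xb xc hy
  obtain ⟨pa, pb, pc⟩ := e3_zero hp
  simp only [Multiset.mem_add, Multiset.mem_singleton] at hv
  rcases hv with (rfl | rfl) | rfl
  · rw [xa, z.yq]; exact ⟨pa, rfl⟩
  · rw [xb, z.yr]; exact ⟨pb, rfl⟩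
  · rw [xc, z.ys]; exact ⟨pc, rfl⟩

theorem MC.twinp (C : Ctx H k) (h : MC H x y p q r s M) (v : V) : A H p v = A H q v := by
  rcases h.part.cover v with hv | ⟨T, hT, hv⟩
  · have px := h.xp; have qx := h.xq; have py := h.yp; have qy := h.yq; have qp := h.pq
    rw [A_comm] at px qx py qy qp
    simp only [Multiset.mem_add, Multiset.mem_singleton] at hv
    rcases hv with ((((rfl | rfl) | rfl) | rfl) | rfl) | rfl
    · rw [px, qx]
    · rw [py, qy]
    · rw [A_self, qp]
    · rw [A_self, h.pq]
    · rw [h.pr, h.qr]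
    · rw [h.ps, h.qs]
  · rcases (h.types C hT).1 with hx | hx
    · rw [h.pz C hT hx hv, h.lt.pz C hT hx hv]
    · rw [(h.xh C hT hx hv).1, (h.lt.xh C hT hx hv).1]

theorem MC.twiny (C : Ctx H k) (h : MC H x y p q r s M) (v : V) (hvy : v ≠ y) (hvs : v ≠ s) :
    A H y v = A H s v := by
  rcases h.part.cover v with hv | ⟨T, hT, hv⟩
  · have yx := h.xy; have sx := h.xs; have sp := h.ps; have sq := h.qs; have sr := h.rs
    rw [A_comm] at yx sx sp sq sr
    simp only [Multiset.mem_add, Multiset.mem_singleton] at hv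
    rcases hv with ((((rfl | rfl) | rfl) | rfl) | rfl) | rfl
    · rw [yx, sx]
    · exact absurd rfl hvy
    · rw [h.yp, sp]
    · rw [h.yq, sq]
    · rw [h.yr, sr]
    · exact absurd rfl hvs
  · rcases (h.types C hT).1 with hx | hx
    · have h1 := h.pz C hT hx hv
      have h2 := h.sw.pz C hT hx hv
      rw [h1] at h2
      exact Bool.not_inj h2
    · have h1 := (h.xh C hT hx hv).2
      have h2 := (h.sw.xh C hT hx hv).2
      rw [h1] at h2
      exact Bool.not_inj h2

theorem MC.nx (C : Ctx H k) (h : MC H x y p q r s M) {v : V} (hv : A H x v = true) (w : V) :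
    A H v w = A H p w := by
  rcases h.part.cover v with hc | ⟨T, hT, hc⟩
  · simp only [Multiset.mem_add, Multiset.mem_singleton] at hc
    rcases hc with ((((rfl | rfl) | rfl) | rfl) | rfl) | rfl
    · rw [A_self] at hv; cases hv
    · rw [h.xy] at hv; cases hv
    · rfl
    · exact (h.twinp C w).symm
    · exact (h.lt2.twinp C w).symm
    · rw [h.xs] at hv; cases hv
  · obtain ⟨hx, hy, -⟩ := h.types C hT
    rcases hx with hx | hx
    · obtain ⟨a, b, rfl⟩ := tri_mem (h.part.ok _ hT) hc
      have := e3_zero hx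
      rw [this.2.2] at hv; cases hv
    · have hp : e H p T = 0 := by have := h.main C hT; omega
      obtain ⟨a, b, c, rfl, xa, xb, xc⟩ := sort_e2 (h.part.ok _ hT) x hx
      obtain ⟨M', rfl⟩ := Multiset.exists_cons_of_mem hT
      have z := h.hconf C hp xa xb xc hy
      simp only [Multiset.mem_add, Multiset.mem_singleton] at hc
      rcases hc with (rfl | rfl) | rfl
      · exact (z.twinp C w).symm
      · exact (z.lt2.twinp C w).symm
      · rw [xc] at hv; cases hv

theorem MC.ny (C : Ctx H k) (h : MC H x y p q r s M) {v : V} (hv : A H y v = true) (w : V)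
    (hwy : w ≠ y) (hwv : w ≠ v) : A H v w = A H y w := by
  rcases h.part.cover v with hc | ⟨T, hT, hc⟩
  · simp only [Multiset.mem_add, Multiset.mem_singleton] at hc
    have yx := h.xy
    rw [A_comm] at yx
    rcases hc with ((((rfl | rfl) | rfl) | rfl) | rfl) | rfl
    · rw [yx] at hv; cases hv
    · exact absurd hv (by rw [A_self]; simp)
    · rw [h.yp] at hv; cases hv
    · rw [h.yq] at hv; cases hv
    · rw [h.yr] at hv; cases hv
    · exact (h.twiny C w hwy hwv).symm
  · obtain ⟨hx, hy, -⟩ := h.types C hT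
    rcases hx with hx | hx
    · have hp : e H p T = 2 := by have := h.main C hT; omega
      obtain ⟨a, b, c, rfl, pa, pb, pc⟩ := sort_e2 (h.part.ok _ hT) p hp
      obtain ⟨M', rfl⟩ := Multiset.exists_cons_of_mem hT
      have z := h.zconf C hx pa pb pc hy
      simp only [Multiset.mem_add, Multiset.mem_singleton] at hc
      rcases hc with (rfl | rfl) | rfl
      · rw [z.yq] at hv; cases hv
      · rw [z.yr] at hv; cases hv
      · exact (z.twiny C w hwy hwv).symm
    · have hp : e H p T = 0 := by have := h.main C hT; omega
      obtain ⟨a, b, c, rfl, xa, xb, xc⟩ := sort_e2 (h.part.ok _ hT) x hx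
      obtain ⟨M', rfl⟩ := Multiset.exists_cons_of_mem hT
      have z := h.hconf C hp xa xb xc hy
      simp only [Multiset.mem_add, Multiset.mem_singleton] at hc
      rcases hc with (rfl | rfl) | rfl
      · rw [z.yq] at hv; cases hv
      · rw [z.yr] at hv; cases hv
      · exact (z.twiny C w hwy hwv).symm

theorem S_even (u : V) (M : Multiset (Multiset V)) (h : ∀ T ∈ M, e H u T = 0 ∨ e H u T = 2) :
    Even (S H u M) := by
  induction M using Multiset.induction with
  | empty => simp [S_zero]
  | cons T M ih =>
    rw [S_cons]
    have := ih fun T hT => h T (Multiset.mem_cons_of_mem hT)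
    rcases h T (Multiset.mem_cons_self _ _) with h0 | h0 <;> rw [h0]
    · simpa using this
    · exact Even.add even_two this

theorem S_one (u : V) (M : Multiset (Multiset V)) (h : ∀ T ∈ M, e H u T = 1) :
    S H u M = Multiset.card M := by
  induction M using Multiset.induction with
  | empty => simp [S_zero]
  | cons T M ih =>
    rw [S_cons, ih fun T hT => h T (Multiset.mem_cons_of_mem hT),
      h T (Multiset.mem_cons_self _ _), Multiset.card_cons, add_comm]

theorem card_nb (u : V) :
    (Finset.univ.filter fun v => A H u v = true).card = e H u (Finset.univ : Finset V).val := by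
  rw [Finset.card_filter]
  show _ = (∑ v, (A H u v).toNat)
  refine Finset.sum_congr rfl fun v _ => ?_
  cases A H u v <;> simp

theorem MC.struct [DecidableEq V] (C : Ctx H k) (h : MC H x y p q r s M) :
    Odd k ∧ ∃ P X W : Finset V, P.card = k ∧ X.card = k ∧ W.card = k ∧
      Disjoint P X ∧ Disjoint P W ∧ Disjoint X W ∧
      (∀ u ∈ P, ∀ v ∈ X, H.Adj u v) ∧ (∀ u ∈ W, ∀ v ∈ W, u ≠ v → H.Adj u v) := by
  have hd := h.degs C
  have g1 := h.part.dsum x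
  have g2 := h.part.dsum p
  have g3 := h.part.dsum y
  have l1 := C.deg x
  have l2 := C.deg p
  have px := h.xp; have py := h.yp; have yx := h.xy
  rw [A_comm] at px py yx
  simp only [e_add, e_single, A_self, h.xy, h.xp, h.xq, h.xr, h.xs, Bool.toNat_true,
      Bool.toNat_false] at g1
  simp only [e_add, e_single, A_self, px, py, h.pq, h.pr, h.ps, Bool.toNat_true,
      Bool.toNat_false] at g2
  simp only [e_add, e_single, A_self, yx, h.yp, h.yq, h.yr, h.ys, Bool.toNat_true,
      Bool.toNat_false] at g3
  have hs := sum_ge (H := H) M 2 1 1 0 0 x p x x fun T hT => by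
    have := h.main C hT; omega
  have hy := S_one y M fun T hT => (h.types C hT).2.1
  obtain ⟨j, hj⟩ := S_even x M fun T hT => (h.types C hT).1
  refine ⟨⟨j + 1, by omega⟩, Finset.univ.filter (fun v => A H x v = true),
    Finset.univ.filter (fun v => A H p v = true),
    insert y (Finset.univ.filter (fun v => A H y v = true)), ?_, ?_, ?_, ?_, ?_, ?_, ?_, ?_⟩
  · rw [card_nb]; omega
  · rw [card_nb]; omega
  · rw [Finset.card_insert_of_notMem (by simp [A_self]), card_nb]; omega
  · rw [Finset.disjoint_left]
    intro v h1 h2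
    simp only [Finset.mem_filter, Finset.mem_univ, true_and] at h1 h2
    have := h.nx C h1 v
    rw [h2, A_self] at this; cases this
  · rw [Finset.disjoint_left]
    intro v h1 h2
    simp only [Finset.mem_filter, Finset.mem_univ, true_and, Finset.mem_insert] at h1 h2
    rcases h2 with rfl | h2
    · rw [h.xy] at h1; cases h1
    · have := h.nx C h1 y
      rw [A_comm, h2, py] at this; cases this
  · rw [Finset.disjoint_left]
    intro v h1 h2
    simp only [Finset.mem_filter, Finset.mem_univ, true_and, Finset.mem_insert] at h1 h2
    rcases h2 with rfl | h2
    · rw [py] at h1; cases h1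
    · have := h.ny C h2 p
        (by rintro rfl; rw [yx] at px; cases px)
        (by rintro rfl; rw [A_self] at h1; cases h1)
      rw [A_comm, h1, h.yp] at this; cases this
  · intro u hu v hv
    simp only [Finset.mem_filter, Finset.mem_univ, true_and] at hu hv
    rw [← A_iff, h.nx C hu v, hv]
  · intro u hu v hv huv
    simp only [Finset.mem_filter, Finset.mem_univ, true_and, Finset.mem_insert] at hu hv
    rw [← A_iff]
    rcases hu with rfl | hu
    · rcases hv with rfl | hv
      · exact absurd rfl huv
      · exact hv
    · rcases hv with rfl | hv
      · rw [A_comm]; exact hu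
      · rw [h.ny C hu v _ huv.symm, hv]
        rintro rfl; rw [A_self] at hv; cases hv

end step3d
end EqCol

namespace EqCol

section wrap
variable {V : Type*} [Fintype V]

theorem split3 {V : Type*} (k : ℕ) : ∀ s : Multiset V, Multiset.card s = 3 * k →
    ∃ M : Multiset (Multiset V), M.sum = s ∧ ∀ T ∈ M, Multiset.card T = 3 := by
  induction k with
  | zero =>
    intro s hs
    refine ⟨0, ?_, by simp⟩
    have : s = 0 := by simpa using hs
    simp [this]
  | succ k ih =>
    intro s hs
    obtain ⟨t, u, rfl, htc⟩ : ∃ t u : Multiset V, s = t + u ∧ Multiset.card t = 3 := by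
      induction s using Quotient.inductionOn with
      | h l =>
        refine ⟨(l.take 3 : List V), (l.drop 3 : List V), ?_, ?_⟩
        · rw [Multiset.coe_add, List.take_append_drop]; rfl
        · have : l.length = 3 * (k + 1) := hs
          rw [Multiset.coe_card, List.length_take]; omega
    rw [Multiset.card_add] at hs
    obtain ⟨M, hM, hM3⟩ := ih u (by omega)
    refine ⟨t ::ₘ M, by rw [Multiset.sum_cons, hM], ?_⟩
    intro T hT
    rcases Multiset.mem_cons.1 hT with rfl | hT
    · exact htc
    · exact hM3 T hT

theorem A_mono {H G : SimpleGraph V} (hle : H ≤ G) (u v : V) : (A H u v).toNat ≤ (A G u v).toNat := by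
  by_cases h : H.Adj u v
  · have h1 := A_iff.2 h
    have h2 := A_iff.2 (hle h)
    rw [h1, h2]
  · have h1 : A H u v = false := by
      rw [← Bool.not_eq_true, A_iff]; exact h
    rw [h1]; simp

theorem exists_min {G : SimpleGraph V} {k : ℕ} (hk : 1 ≤ k) (C : Ctx G k) :
    ∃ H ≤ G, Ctx H k ∧ ∃ x z y M, OC H x z y M := by
  classical
  obtain ⟨H, hle, hmin⟩ := exists_minimal_le_of_wellFoundedLT
    (fun H : SimpleGraph V => ∀ M, ¬ Part H 0 M) G C.ne
  have CH : Ctx H k := by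
    refine ⟨C.card, fun u => le_trans ?_ (C.deg u), hmin.prop⟩
    show (∑ v, (A H u v).toNat) ≤ ∑ v, (A G u v).toNat
    exact Finset.sum_le_sum fun v _ => A_mono hle u v
  refine ⟨H, hle, CH, ?_⟩
  have hedge : ∃ x z, H.Adj x z := by
    by_contra hno
    push Not at hno
    obtain ⟨M, hM, hM3⟩ := split3 k (Finset.univ : Finset V).val C.card
    refine CH.ne M ⟨by rw [hM, zero_add], fun T hT => ⟨hM3 T hT, fun u _ v _ => ?_⟩⟩
    rw [← Bool.not_eq_true, A_iff]; exact hno u v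
  obtain ⟨x, z, hxz⟩ := hedge
  have hlt : ¬ ∀ M, ¬ Part (H.deleteEdges {s(x, z)}) 0 M := by
    intro hP
    have := hmin.le_of_le hP (SimpleGraph.deleteEdges_le _)
    have := this hxz
    simp at this
  push Not at hlt
  obtain ⟨M, hM⟩ := hlt
  have tr : ∀ T ∈ M, ∀ u ∈ T, ∀ v ∈ T, H.Adj u v → s(u, v) = s(x, z) := by
    intro T hT u hu v hv huv
    have h1 := (hM.ok T hT).2 u hu v hv
    rw [← Bool.not_eq_true, A_iff, SimpleGraph.deleteEdges_adj] at h1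
    by_contra hne
    exact h1 ⟨huv, by simpa using hne⟩
  have good : ∀ T ∈ M, (x ∉ T ∨ z ∉ T) → Tri H T := by
    intro T hT hn
    refine ⟨(hM.ok T hT).1, fun u hu v hv => ?_⟩
    rw [← Bool.not_eq_true, A_iff]
    intro huv
    have := tr T hT u hu v hv huv
    rw [Sym2.eq_iff] at this
    rcases this with ⟨rfl, rfl⟩ | ⟨rfl, rfl⟩ <;> tauto
  have hT : ∃ T ∈ M, x ∈ T ∧ z ∈ T := by
    by_contra hno
    refine CH.ne M ⟨hM.sum, fun T hT => good T hT ?_⟩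
    by_contra h2
    exact hno ⟨T, hT, by tauto⟩
  obtain ⟨T, hT, hx, hz⟩ := hT
  have hnd : (0 + M.sum).Nodup := by rw [hM.sum]; exact Finset.univ.nodup
  obtain ⟨M', rfl⟩ := Multiset.exists_cons_of_mem hT
  have hTr := hM.ok T hT
  have : ∃ y, T = {x} + {z} + {y} := by
    obtain ⟨a, b, rfl⟩ := tri_mem hTr hx
    simp only [Multiset.mem_add, Multiset.mem_singleton] at hz
    rcases hz with (rfl | rfl) | rfl
    · exact ⟨b, by abel⟩
    · exact ⟨a, by abel⟩
    · exact absurd hxz (H.loopless.irrefl _)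
  obtain ⟨y, rfl⟩ := this
  rw [Multiset.sum_cons, zero_add, Multiset.nodup_add] at hnd
  obtain ⟨hn1, hn2, hdis⟩ := hnd
  have hzy : z ≠ y := by
    rintro rfl
    have := Multiset.nodup_iff_count_le_one.1 hn1 z
    simp only [Multiset.count_add, Multiset.count_singleton_self] at this
    omega
  have hxy : x ≠ y := by
    rintro rfl
    have := Multiset.nodup_iff_count_le_one.1 hn1 x
    simp only [Multiset.count_add, Multiset.count_singleton_self] at this
    omega
  refine ⟨x, z, y, M', ⟨?_, ?_⟩, A_iff.2 hxz, ?_, ?_⟩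
  · have := hM.sum
    rw [Multiset.sum_cons, zero_add] at this
    exact this
  · intro T' hT'
    refine good T' (Multiset.mem_cons_of_mem hT') (Or.inl fun hx' => ?_)
    refine Multiset.disjoint_left.1 hdis hx ?_
    exact Multiset.mem_of_le (Multiset.le_sum_of_mem hT') hx'
  · rw [← Bool.not_eq_true, A_iff]
    intro h
    have := tr _ hT x (by simp) y (by simp) h
    rw [Sym2.eq_iff] at this
    rcases this with ⟨_, h⟩ | ⟨_, h⟩
    · exact hzy h.symm
    · exact hxy h.symm
  · rw [← Bool.not_eq_true, A_iff]
    intro h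
    have := tr _ hT z (by simp) y (by simp) h
    rw [Sym2.eq_iff] at this
    rcases this with ⟨_, h⟩ | ⟨_, h⟩
    · exact hzy h.symm
    · exact hxy h.symm

theorem all_three {k : ℕ} (n : Fin k → ℕ) (hs : ∑ i, n i = 3 * k)
    (hn : ∀ i j, n i ≤ n j + 1) (i : Fin k) : n i = 3 := by
  have hc : ∑ _i : Fin k, 3 = 3 * k := by simp [mul_comm]
  rcases lt_trichotomy (n i) 3 with h | h | h
  · exfalso
    have : ∑ j, n j < ∑ _j : Fin k, 3 :=
      Finset.sum_lt_sum (fun j _ => by have := hn j i; omega) ⟨i, Finset.mem_univ i, h⟩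
    omega
  · exact h
  · exfalso
    have : ∑ _j : Fin k, 3 < ∑ j, n j :=
      Finset.sum_lt_sum (fun j _ => by have := hn i j; omega) ⟨i, Finset.mem_univ i, h⟩
    omega

theorem equitable_of_part {G : SimpleGraph V} {k : ℕ} (hcard : Fintype.card V = 3 * k)
    {M : Multiset (Multiset V)} (h : Part G 0 M) : G.HasEquitableColoring k := by
  classical
  have hM : Multiset.card M = k := by
    have h1 : ∀ M : Multiset (Multiset V), (∀ T ∈ M, Tri G T) →
        Multiset.card M.sum = 3 * Multiset.card M := by
      intro M
      induction M using Multiset.induction with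
      | empty => simp
      | cons T M ih =>
        intro h
        have h1 := (h T (Multiset.mem_cons_self _ _)).1
        have h2 := ih fun T hT => h T (Multiset.mem_cons_of_mem hT)
        simp only [Multiset.sum_cons, Multiset.card_add, Multiset.card_cons]
        omega
    have h2 := congrArg Multiset.card h.sum
    rw [Multiset.card_add, h1 M h.ok, Multiset.card_zero] at h2
    have h3 : Multiset.card (Finset.univ : Finset V).val = 3 * k := hcard
    omega
  induction M using Quotient.inductionOn with
  | h l =>
    have hl : l.length = k := hM
    subst hl
    have hex : ∀ v : V, ∃ i : Fin l.length, v ∈ l.get i := by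
      intro v
      rcases h.cover v with hv | ⟨T, hT, hv⟩
      · simp at hv
      · have hT : T ∈ l := hT
        obtain ⟨i, hi⟩ := List.get_of_mem hT
        exact ⟨i, by rw [hi]; exact hv⟩
    choose c hc using hex
    have htri : ∀ i : Fin l.length, Tri G (l.get i) := fun i => h.ok _ (List.get_mem l i)
    have hle : ∀ i, (Finset.univ.filter fun v => c v = i).card ≤ 3 := by
      intro i
      have hsub : (Finset.univ.filter fun v => c v = i) ⊆ (l.get i).toFinset := by
        intro v hv
        rw [Finset.mem_filter] at hv
        rw [Multiset.mem_toFinset, ← hv.2]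
        exact hc v
      refine (Finset.card_le_card hsub).trans ((Multiset.toFinset_card_le _).trans ?_)
      rw [(htri i).1]
    have hsum : ∑ i, (Finset.univ.filter fun v => c v = i).card = 3 * l.length := by
      rw [← hcard, ← Finset.card_univ (α := V)]
      exact (Finset.card_eq_sum_card_fiberwise fun _ _ => Finset.mem_coe.2 (Finset.mem_univ _)).symm
    have heq : ∀ i, (Finset.univ.filter fun v => c v = i).card = 3 := by
      have := (Finset.sum_eq_sum_iff_of_le (s := Finset.univ)
        (f := fun i => (Finset.univ.filter fun v => c v = i).card) (g := fun _ => 3)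
        fun i _ => hle i).1 (by rw [hsum]; simp [mul_comm])
      exact fun i => this i (Finset.mem_univ i)
    refine ⟨SimpleGraph.Coloring.mk c ?_, ?_⟩
    · intro u v huv hcuv
      have h1 := (htri (c u)).2 u (hc u) v (by rw [hcuv]; exact hc v)
      rw [A_iff.2 huv] at h1; cases h1
    · intro i j
      have h1 := heq i
      have h2 := heq j
      show (Finset.univ.filter fun v => c v = i).card ≤ (Finset.univ.filter fun v => c v = j).card + 1
      omega

theorem iso_of_struct {G : SimpleGraph V} {k : ℕ} (hcard : Fintype.card V = 3 * k)
    [DecidableRel G.Adj] (hdeg : ∀ v, G.degree v ≤ k)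
    {P X W : Finset V} (hP : P.card = k) (hX : X.card = k) (hW : W.card = k)
    (hPX : Disjoint P X) (hPW : Disjoint P W) (hXW : Disjoint X W)
    (h1 : ∀ u ∈ P, ∀ v ∈ X, G.Adj u v) (h2 : ∀ u ∈ W, ∀ v ∈ W, u ≠ v → G.Adj u v) :
    Nonempty (G ≃g SimpleGraph.disjUnion
        (completeBipartiteGraph (Fin k) (Fin k)) (⊤ : SimpleGraph (Fin k))) := by
  have nb : ∀ (u : V) (Y : Finset V), Y.card = k → (∀ v ∈ Y, G.Adj u v) →
      ∀ v, G.Adj u v ↔ v ∈ Y := by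
    intro u Y hY hu v
    have : Y = G.neighborFinset u := by
      refine Finset.eq_of_subset_of_card_le (fun v hv => ?_) ?_
      · rw [SimpleGraph.mem_neighborFinset]; exact hu v hv
      · rw [SimpleGraph.card_neighborFinset_eq_degree, hY]; exact hdeg u
    rw [this, SimpleGraph.mem_neighborFinset]
  have nP : ∀ u ∈ P, ∀ v, G.Adj u v ↔ v ∈ X := fun u hu => nb u X hX (h1 u hu)
  have nX : ∀ u ∈ X, ∀ v, G.Adj u v ↔ v ∈ P :=
    fun u hu => nb u P hP fun v hv => (h1 v hv u hu).symm
  let eP := Finset.equivFinOfCardEq hP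
  let eX := Finset.equivFinOfCardEq hX
  let eW := Finset.equivFinOfCardEq hW
  let f : (Fin k ⊕ Fin k) ⊕ Fin k → V :=
    Sum.elim (Sum.elim (fun i => (eP.symm i : V)) (fun i => (eX.symm i : V)))
      (fun i => (eW.symm i : V))
  have dPX : ∀ i j, (eP.symm i : V) ≠ (eX.symm j : V) := fun i j h =>
    Finset.disjoint_left.1 hPX (eP.symm i).2 (h ▸ (eX.symm j).2)
  have dPW : ∀ i j, (eP.symm i : V) ≠ (eW.symm j : V) := fun i j h =>
    Finset.disjoint_left.1 hPW (eP.symm i).2 (h ▸ (eW.symm j).2)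
  have dXW : ∀ i j, (eX.symm i : V) ≠ (eW.symm j : V) := fun i j h =>
    Finset.disjoint_left.1 hXW (eX.symm i).2 (h ▸ (eW.symm j).2)
  have finj : Function.Injective f := by
    rintro ((i | i) | i) ((j | j) | j) h <;> simp only [f, Sum.elim_inl, Sum.elim_inr] at h
    · rw [eP.symm.injective (Subtype.ext h)]
    · exact absurd h (dPX _ _)
    · exact absurd h (dPW _ _)
    · exact absurd h.symm (dPX _ _)
    · rw [eX.symm.injective (Subtype.ext h)]
    · exact absurd h (dXW _ _)
    · exact absurd h.symm (dPW _ _)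
    · exact absurd h.symm (dXW _ _)
    · rw [eW.symm.injective (Subtype.ext h)]
  have fbij : Function.Bijective f := by
    rw [Fintype.bijective_iff_injective_and_card]
    refine ⟨finj, ?_⟩
    simp [hcard]; omega
  refine ⟨(SimpleGraph.Iso.symm ⟨Equiv.ofBijective f fbij, ?_⟩)⟩
  have mP : ∀ i, (eP.symm i : V) ∈ P := fun i => (eP.symm i).2
  have mX : ∀ i, (eX.symm i : V) ∈ X := fun i => (eX.symm i).2
  have mW : ∀ i, (eW.symm i : V) ∈ W := fun i => (eW.symm i).2
  have hXP := hPX.symm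
  have hWP := hPW.symm
  have hWX := hXW.symm
  rw [Finset.disjoint_left] at hPX hPW hXW hXP hWP hWX
  rintro ((i | i) | i) ((j | j) | j) <;>
    simp only [Equiv.ofBijective_apply, f, Sum.elim_inl, Sum.elim_inr, SimpleGraph.disjUnion,
      completeBipartiteGraph_adj, SimpleGraph.top_adj]
  · rw [nP _ (mP i)]; simpa using hPX (mP j)
  · rw [nP _ (mP i)]; simpa using mX j
  · rw [nP _ (mP i)]; simpa using hWX (mW j)
  · rw [nX _ (mX i)]; simpa using mP j
  · rw [nX _ (mX i)]; simpa using hXP (mX j)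
  · rw [nX _ (mX i)]; simpa using hWP (mW j)
  · rw [G.adj_comm, nP _ (mP j)]; simpa using hWX (mW i)
  · rw [G.adj_comm, nX _ (mX j)]; simpa using hWP (mW i)
  · constructor
    · rintro h rfl
      exact G.loopless.irrefl _ h
    · intro hij
      exact h2 _ (mW i) _ (mW j) fun h => hij (eW.symm.injective (Subtype.ext h))

theorem no_equitable_of_iso {G : SimpleGraph V} {k : ℕ} (hcard : Fintype.card V = 3 * k)
    (hodd : Odd k) (φ : G ≃g SimpleGraph.disjUnion
        (completeBipartiteGraph (Fin k) (Fin k)) (⊤ : SimpleGraph (Fin k))) :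
    ¬ G.HasEquitableColoring k := by
  classical
  rintro ⟨C, hC⟩
  have hsum : ∑ i, (Finset.univ.filter fun v => C v = i).card = 3 * k := by
    rw [← hcard, ← Finset.card_univ (α := V)]
    exact (Finset.card_eq_sum_card_fiberwise fun _ _ => Finset.mem_coe.2 (Finset.mem_univ _)).symm
  have h3 := all_three (fun i => (Finset.univ.filter fun v => C v = i).card) hsum hC
  let D := fun v => C (φ.symm v)
  have hD : ∀ u v, (SimpleGraph.disjUnion
        (completeBipartiteGraph (Fin k) (Fin k)) (⊤ : SimpleGraph (Fin k))).Adj u v → D u ≠ D v :=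
    fun u v huv => C.valid (φ.symm.map_rel_iff.2 huv)
  let a : Fin k → ℕ := fun i => ∑ j : Fin k, if D (Sum.inl (Sum.inl j)) = i then 1 else 0
  let b : Fin k → ℕ := fun i => ∑ j : Fin k, if D (Sum.inl (Sum.inr j)) = i then 1 else 0
  let c : Fin k → ℕ := fun i => ∑ j : Fin k, if D (Sum.inr j) = i then 1 else 0
  have habc : ∀ i, a i + b i + c i = 3 := by
    intro i
    have := h3 i
    rw [← this, Finset.card_filter, ← Equiv.sum_comp φ.symm.toEquiv, Fintype.sum_sum_type,
      Fintype.sum_sum_type]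
    rfl
  have hc : ∀ i, c i = 1 := by
    have hinj : Function.Injective fun j : Fin k => D (Sum.inr j) := by
      intro i j hij
      by_contra hne
      exact hD (Sum.inr i) (Sum.inr j) hne hij
    have hbij := Finite.injective_iff_bijective.1 hinj
    intro i
    obtain ⟨j, hj⟩ := hbij.2 i
    have hj : D (Sum.inr j) = i := hj
    show (∑ j : Fin k, if D (Sum.inr j) = i then 1 else 0) = 1
    rw [Finset.sum_eq_single j]
    · simp [hj]
    · intro l _ hl
      rw [if_neg]
      intro h
      exact hl (hinj (h.trans hj.symm))
    · simp
  have hab : ∀ i, a i = 0 ∨ b i = 0 := by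
    intro i
    by_contra hcon
    push Not at hcon
    obtain ⟨j, _, hj⟩ := Finset.exists_ne_zero_of_sum_ne_zero hcon.1
    obtain ⟨l, _, hl⟩ := Finset.exists_ne_zero_of_sum_ne_zero hcon.2
    have hj : D (Sum.inl (Sum.inl j)) = i := by by_contra h; simp [h] at hj
    have hl : D (Sum.inl (Sum.inr l)) = i := by by_contra h; simp [h] at hl
    refine hD (Sum.inl (Sum.inl j)) (Sum.inl (Sum.inr l)) ?_ (hj.trans hl.symm)
    simp [SimpleGraph.disjUnion]
  have hev : ∀ i, Even (a i) := by
    intro i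
    have h1 := habc i
    have h2 := hc i
    rcases hab i with h | h
    · rw [h]; simp
    · exact ⟨1, by omega⟩
  have hk : ∑ i, a i = k := by
    show (∑ i, ∑ j : Fin k, if D (Sum.inl (Sum.inl j)) = i then 1 else 0) = k
    rw [Finset.sum_comm]
    simp
  have : Even k := by
    rw [← hk]
    exact Finset.even_sum _ fun i _ => hev i
  exact Nat.not_even_iff_odd.2 hodd this

end wrap
end EqCol

/-- A graph `G` on `3k` vertices with `χ(G) ≤ k` and `Δ(G) ≤ k` has no equitable `k`-coloring
if and only if `k` is odd and `G` is isomorphic to `K_{k,k} + K_k`. -/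
theorem no_equitable_iff {V : Type*} [Fintype V] (G : SimpleGraph V) [DecidableRel G.Adj]
    (k : ℕ) (hk : 1 ≤ k) (hcard : Fintype.card V = 3 * k)
    (hchrom : G.chromaticNumber ≤ k) (hdeg : G.maxDegree ≤ k) :
    ¬ G.HasEquitableColoring k ↔
      (Odd k ∧ Nonempty (G ≃g SimpleGraph.disjUnion
        (completeBipartiteGraph (Fin k) (Fin k)) (⊤ : SimpleGraph (Fin k)))) := by
  classical
  constructor
  · intro hno
    have C : EqCol.Ctx G k := by
      refine ⟨hcard, fun u => ?_, fun M hM => hno (EqCol.equitable_of_part hcard hM)⟩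
      rw [EqCol.deg_eq]
      exact (G.degree_le_maxDegree u).trans hdeg
    have hcol : G.Colorable k := SimpleGraph.chromaticNumber_le_iff_colorable.1 hchrom
    obtain ⟨H, hle, CH, x, z, y, M, hO⟩ := EqCol.exists_min hk C
    obtain ⟨x, y, p, q, r, s, M, hN⟩ := hO.existsNC CH (hcol.mono_left hle)
    obtain ⟨x, y, p, q, r, s, M, hM⟩ := hN.toMC CH
    obtain ⟨hodd, P, X, W, hP, hX, hW, d1, d2, d3, h1, h2⟩ := hM.struct CH
    exact ⟨hodd, EqCol.iso_of_struct hcard (fun v => (G.degree_le_maxDegree v).trans hdeg)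
      hP hX hW d1 d2 d3 (fun u hu v hv => hle (h1 u hu v hv))
      (fun u hu v hv huv => hle (h2 u hu v hv huv))⟩
  · rintro ⟨hodd, ⟨φ⟩⟩
    exact EqCol.no_equitable_of_iso hcard hodd φ
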